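/- arXiv:2601.19797 — 4 statements merged into one kernel-verified Lean document; each statement's English description precedes it below -/
import Mathlib

section
/- Let ρ satisfy (H0). Then for every u ∈ C_c^∞(ℝ^n) and every v ∈ C_c^∞(ℝ^n; ℝ^n), ∫_{ℝ^n} D_ρ u(x) · v(x) dx = −∫_{ℝ^n} u(x) div_ρ v(x) dx. (Nonlocal integration by parts formula.) -/
open MeasureTheory Metric Set Matrix
open scoped ENNReal InnerProductSpace

noncomputable section

/-- Points of `ℝ^n` with the Euclidean norm. -/
abbrev Eu (n : ℕ) := EuclideanSpace ℝ (Fin n)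

/-- Hypothesis (H0): `ρ` is a nonnegative radial kernel (with radial representation `ρb`),
locally integrable, with `∫ min{1,|x|⁻¹} ρ(x) dx < ∞`, and bounded below away from zero
on a closed ball of some radius `ε > 0`. -/
def IsKernelH0 (n : ℕ) (ρ : Eu n → ℝ) (ρb : ℝ → ℝ) (ε : ℝ) : Prop :=
  (∀ x, 0 ≤ ρ x) ∧
  (∀ x : Eu n, x ≠ 0 → ρ x = ρb ‖x‖) ∧
  LocallyIntegrable ρ volume ∧
  Integrable (fun x : Eu n => min 1 ‖x‖⁻¹ * ρ x) volume ∧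
  0 < ε ∧
  ∃ c > (0 : ℝ), ∀ x ∈ closedBall (0 : Eu n) ε, x ≠ 0 → c ≤ ρ x

/-- The auxiliary function `f_ρ(r) = r^(n-2) ρ̄(r)`. -/
def fRho (n : ℕ) (ρb : ℝ → ℝ) (r : ℝ) : ℝ := r ^ ((n : ℝ) - 2) * ρb r

/-- Hypothesis (H1): `f_ρ` and `r ↦ r^ν f_ρ(r)` are decreasing on `(0, ε)` for some `ν > 0`. -/
def IsKernelH1 (n : ℕ) (ρb : ℝ → ℝ) (ε : ℝ) : Prop :=
  ∃ ν > (0 : ℝ), AntitoneOn (fRho n ρb) (Ioo 0 ε) ∧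
    AntitoneOn (fun r => r ^ ν * fRho n ρb r) (Ioo 0 ε)

/-- Hypothesis (H2): `f_ρ` is smooth away from the origin and its derivatives satisfy
`|f_ρ^{(k)}(r)| ≤ C(k) r^(-k) f_ρ(r)` on `(0, ε)`. -/
def IsKernelH2 (n : ℕ) (ρb : ℝ → ℝ) (ε : ℝ) : Prop :=
  ContDiffOn ℝ (⊤ : ℕ∞) (fRho n ρb) (Ioi 0) ∧
  ∀ k : ℕ, 0 < k → ∃ C > (0 : ℝ), ∀ r ∈ Ioo (0 : ℝ) ε,
    |iteratedDerivWithin k (fRho n ρb) (Ioi 0) r| ≤ C * r ^ (-(k : ℝ)) * fRho n ρb r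

/-- Hypothesis (H3): `r ↦ r^(n+s-1) ρ̄(r)` is almost decreasing on `(0, ε)` for some `s ∈ (0,1)`. -/
def IsKernelH3 (n : ℕ) (ρb : ℝ → ℝ) (ε : ℝ) : Prop :=
  ∃ s ∈ Ioo (0 : ℝ) 1, ∃ C > (0 : ℝ), ∀ r₁ ∈ Ioo (0 : ℝ) ε, ∀ r₂ ∈ Ioo (0 : ℝ) ε, r₁ ≤ r₂ →
    C * (r₂ ^ ((n : ℝ) + s - 1) * ρb r₂) ≤ r₁ ^ ((n : ℝ) + s - 1) * ρb r₁

/-- Hypothesis (H4): `r ↦ r^(n+t-1) ρ̄(r)` is almost increasing on `(0, ε)` for some `t ∈ (0,1)`. -/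
def IsKernelH4 (n : ℕ) (ρb : ℝ → ℝ) (ε : ℝ) : Prop :=
  ∃ t ∈ Ioo (0 : ℝ) 1, ∃ C > (0 : ℝ), ∀ r₁ ∈ Ioo (0 : ℝ) ε, ∀ r₂ ∈ Ioo (0 : ℝ) ε, r₁ ≤ r₂ →
    C * (r₁ ^ ((n : ℝ) + t - 1) * ρb r₁) ≤ r₂ ^ ((n : ℝ) + t - 1) * ρb r₂

variable {n : ℕ}

/-- Nonlocal gradient of a scalar field:
`D_ρ u(x) = ∫ ((u(x) - u(y))/|x-y|) ((x-y)/|x-y|) ρ(x-y) dy`. -/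
def nlGradS (ρ : Eu n → ℝ) (u : Eu n → ℝ) (x : Eu n) : Eu n :=
  ∫ y, ((u x - u y) * ρ (x - y) / ‖x - y‖ ^ 2) • (x - y)

/-- The (i,j) entry of the integrand of the nonlocal gradient of a vector field. -/
def nlGradMInt (ρ : Eu n → ℝ) (u : Eu n → Eu n) (x : Eu n) (i j : Fin n) : Eu n → ℝ :=
  fun y => (u x - u y) i * (x - y) j * ρ (x - y) / ‖x - y‖ ^ 2

/-- Nonlocal gradient of a vector field, as a matrix:
`D_ρ u(x) = ∫ ((u(x)-u(y))/|x-y|) ⊗ ((x-y)/|x-y|) ρ(x-y) dy`. -/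
def nlGradM (ρ : Eu n → ℝ) (u : Eu n → Eu n) (x : Eu n) : Matrix (Fin n) (Fin n) ℝ :=
  Matrix.of fun i j => ∫ y, nlGradMInt ρ u x i j y

/-- The integrand of the nonlocal divergence of a vector field. -/
def nlDivVInt (ρ : Eu n → ℝ) (u : Eu n → Eu n) (x : Eu n) : Eu n → ℝ :=
  fun y => ⟪u x - u y, x - y⟫_ℝ * ρ (x - y) / ‖x - y‖ ^ 2

/-- Nonlocal divergence of a vector field:
`div_ρ u(x) = ∫ ((u(x)-u(y))·(x-y)/|x-y|²) ρ(x-y) dy`. -/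
def nlDivV (ρ : Eu n → ℝ) (u : Eu n → Eu n) (x : Eu n) : ℝ :=
  ∫ y, nlDivVInt ρ u x y

/-- The i-th component of the integrand of the nonlocal divergence of a matrix field. -/
def nlDivMInt (ρ : Eu n → ℝ) (Φ : Eu n → Matrix (Fin n) (Fin n) ℝ) (x : Eu n) (i : Fin n) :
    Eu n → ℝ :=
  fun y => (∑ j, (Φ x i j - Φ y i j) * (x - y) j) * ρ (x - y) / ‖x - y‖ ^ 2

/-- Nonlocal divergence of a matrix field:
`div_ρ Φ(x) = ∫ ((Φ(x)-Φ(y))/|x-y|) ((x-y)/|x-y|) ρ(x-y) dy ∈ ℝ^n`. -/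
def nlDivM (ρ : Eu n → ℝ) (Φ : Eu n → Matrix (Fin n) (Fin n) ℝ) (x : Eu n) : Eu n :=
  (WithLp.equiv 2 (Fin n → ℝ)).symm fun i => ∫ y, nlDivMInt ρ Φ x i y

/-- Frobenius inner product `A : B = Σ_{ij} a_{ij} b_{ij}` of matrices. -/
def frobInner (A B : Matrix (Fin n) (Fin n) ℝ) : ℝ := ∑ i, ∑ j, A i j * B i j

/-- Symmetric part of a matrix, `M_sym = (M + Mᵀ)/2`. -/
def symPart (M : Matrix (Fin n) (Fin n) ℝ) : Matrix (Fin n) (Fin n) ℝ :=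
  (1 / 2 : ℝ) • (M + Mᵀ)

/-- The potential `Q_ρ(x) = ∫_{|x|}^∞ ρ̄(t)/t dt`. -/
def Qker (n : ℕ) (ρb : ℝ → ℝ) (x : Eu n) : ℝ := ∫ t in Ioi ‖x‖, ρb t / t

/-- Classical Jacobian matrix of a vector field, `(Du)_{ij} = ∂u_i/∂x_j`. -/
def jacobianM (u : Eu n → Eu n) (x : Eu n) : Matrix (Fin n) (Fin n) ℝ :=
  Matrix.of fun i j => fderiv ℝ (fun z => u z i) x (EuclideanSpace.single j 1)

/-- Rank-one matrix `a ⊗ b = (a_i b_j)`. -/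
def tensorP (a b : Eu n) : Matrix (Fin n) (Fin n) ℝ := Matrix.of fun i j => a i * b j

/-- Isotropic elasticity tensor `C[M] = 2μ M_sym + λ (tr M) I`. -/
def isoC (μ lam : ℝ) (M : Matrix (Fin n) (Fin n) ℝ) : Matrix (Fin n) (Fin n) ℝ :=
  (2 * μ) • symPart M + (lam * Matrix.trace M) • (1 : Matrix (Fin n) (Fin n) ℝ)

/-- Fourier transform `𝓕 f(ξ) = ∫ f(x) e^{-2πi x·ξ} dx` of a complex-valued function on ℝ^n. -/
def fInt (f : Eu n → ℂ) (ξ : Eu n) : ℂ :=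
  ∫ x, f x * Complex.exp (-(2 * Real.pi * (⟪x, ξ⟫_ℝ : ℝ) * Complex.I))

/-- The nonlocal Laplacian `(-Δ)_ρ v = -div_ρ (D_ρ v)` of a vector field. -/
def nlLap (ρ : Eu n → ℝ) (v : Eu n → Eu n) (x : Eu n) : Eu n :=
  -nlDivM ρ (fun z => nlGradM ρ v z) x

/-- The i-th component of the integrand of `K_{ρ,φ}(Φ)` from the nonlocal Leibniz rule. -/
def KtermInt (ρ : Eu n → ℝ) (φ : Eu n → ℝ) (Φ : Eu n → Matrix (Fin n) (Fin n) ℝ)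
    (x : Eu n) (i : Fin n) : Eu n → ℝ :=
  fun y => (φ x - φ y) * (∑ j, Φ y i j * (x - y) j) * ρ (x - y) / ‖x - y‖ ^ 2

/-- `K_{ρ,φ}(Φ)(x) = ∫ ((φ(x)-φ(y))/|x-y|) Φ(y) ((x-y)/|x-y|) ρ(x-y) dy`. -/
def Kterm (ρ : Eu n → ℝ) (φ : Eu n → ℝ) (Φ : Eu n → Matrix (Fin n) (Fin n) ℝ)
    (x : Eu n) : Eu n :=
  (WithLp.equiv 2 (Fin n → ℝ)).symm fun i => ∫ y, KtermInt ρ φ Φ x i y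

/-- Classical divergence of a vector field. -/
def divCl (w : Eu n → Eu n) (x : Eu n) : ℝ :=
  ∑ i, fderiv ℝ (fun z => w z i) x (EuclideanSpace.single i 1)

/-- The vector kernel `z ↦ ρ(z) z / |z|²` of the nonlocal gradient and divergence. -/
def nlKer (ρ : Eu n → ℝ) (z : Eu n) : Eu n := (ρ z / ‖z‖ ^ 2) • z

theorem nlKer_neg {ρ : Eu n → ℝ} {ρb : ℝ → ℝ} (hρ : ∀ x : Eu n, x ≠ 0 → ρ x = ρb ‖x‖)
    (z : Eu n) : nlKer ρ (-z) = -nlKer ρ z := by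
  rcases eq_or_ne z 0 with rfl | hz
  · simp [nlKer]
  · simp [nlKer, hρ z hz, hρ (-z) (neg_ne_zero.2 hz)]

theorem norm_nlKer {ρ : Eu n → ℝ} (hρ : ∀ x, 0 ≤ ρ x) (z : Eu n) :
    ‖nlKer ρ z‖ = ‖z‖⁻¹ * ρ z := by
  rcases eq_or_ne z 0 with rfl | hz
  · simp [nlKer]
  · have : ‖z‖ ≠ 0 := norm_ne_zero_iff.2 hz
    rw [nlKer, norm_smul, Real.norm_of_nonneg (div_nonneg (hρ z) (by positivity))]
    field_simp

theorem aestronglyMeasurable_nlKer {ρ : Eu n → ℝ} (hρ : AEStronglyMeasurable ρ volume) :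
    AEStronglyMeasurable (nlKer ρ) volume := by
  have h : AEStronglyMeasurable (fun z : Eu n => (‖z‖ ^ 2)⁻¹) volume :=
    (by fun_prop : Measurable fun z : Eu n => (‖z‖ ^ 2)⁻¹).aestronglyMeasurable
  exact (hρ.mul h).smul aestronglyMeasurable_id

/-- Increments of a smooth compactly supported function compensate the singularity of the kernel. -/
theorem exists_norm_sub_mul_norm_nlKer_le {V : Type*} [NormedAddCommGroup V] [NormedSpace ℝ V]
    {ρ : Eu n → ℝ} (hρ : ∀ x, 0 ≤ ρ x) {f : Eu n → V}
    (hf : ContDiff ℝ (⊤ : ℕ∞) f) (hfs : HasCompactSupport f) :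
    ∃ C : ℝ, ∀ x z, ‖f x - f (x - z)‖ * ‖nlKer ρ z‖ ≤ C * (min 1 ‖z‖⁻¹ * ρ z) := by
  obtain ⟨L, hL⟩ := ContDiff.lipschitzWith_of_hasCompactSupport hfs hf (by simp)
  obtain ⟨B, hB⟩ := hfs.exists_bound_of_continuous hf.continuous
  have hB0 : 0 ≤ B := (norm_nonneg _).trans (hB 0)
  refine ⟨L + 2 * B, fun x z => ?_⟩
  rw [norm_nlKer hρ, ← mul_assoc, ← mul_assoc]
  refine mul_le_mul_of_nonneg_right ?_ (hρ z)
  rw [mul_min_of_nonneg _ _ (by positivity)]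
  refine le_min ?_ ?_
  · have h : ‖f x - f (x - z)‖ ≤ L * ‖z‖ := by simpa using hL.norm_sub_le x (x - z)
    calc ‖f x - f (x - z)‖ * ‖z‖⁻¹ ≤ L * ‖z‖ * ‖z‖⁻¹ := by gcongr
      _ ≤ L * 1 := by rw [mul_assoc]; gcongr; exact mul_inv_le_one
      _ ≤ (L + 2 * B) * 1 := by gcongr; linarith
  · refine mul_le_mul_of_nonneg_right ?_ (by positivity)
    have h := norm_sub_le (f x) (f (x - z))
    have h1 := hB x
    have h2 := hB (x - z)
    have h3 : (0 : ℝ) ≤ L := L.2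
    linarith

theorem integrable_smul_nlKer {ρ : Eu n → ℝ} (hρ : ∀ x, 0 ≤ ρ x)
    (hρm : AEStronglyMeasurable ρ volume)
    (hρi : Integrable (fun x : Eu n => min 1 ‖x‖⁻¹ * ρ x) volume)
    {u : Eu n → ℝ} (hu : ContDiff ℝ (⊤ : ℕ∞) u) (hus : HasCompactSupport u) (x : Eu n) :
    Integrable fun z => (u x - u (x - z)) • nlKer ρ z := by
  obtain ⟨C, hC⟩ := exists_norm_sub_mul_norm_nlKer_le hρ hu hus
  have hc := hu.continuous
  have hm : AEStronglyMeasurable (fun z => u x - u (x - z)) volume :=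
    Continuous.aestronglyMeasurable (by fun_prop)
  refine (hρi.const_mul C).mono' (hm.smul (aestronglyMeasurable_nlKer hρm))
    (.of_forall fun z => ?_)
  rw [norm_smul]
  exact hC x z

theorem integrable_prod_mul_inner_nlKer {ρ : Eu n → ℝ} (hρ : ∀ x, 0 ≤ ρ x)
    (hρm : AEStronglyMeasurable ρ volume)
    (hρi : Integrable (fun x : Eu n => min 1 ‖x‖⁻¹ * ρ x) volume)
    {u : Eu n → ℝ} (hu : ContDiff ℝ (⊤ : ℕ∞) u) (hus : HasCompactSupport u)
    {v : Eu n → Eu n} (hv : Continuous v) (hvs : HasCompactSupport v) :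
    Integrable (fun p : Eu n × Eu n => (u p.1 - u (p.1 - p.2)) * ⟪v p.1, nlKer ρ p.2⟫_ℝ)
      (volume.prod volume) := by
  obtain ⟨C, hC⟩ := exists_norm_sub_mul_norm_nlKer_le hρ hu hus
  have hc := hu.continuous
  have hk := (aestronglyMeasurable_nlKer hρm).comp_snd (μ := (volume : Measure (Eu n)))
  refine ((hv.norm.integrable_of_hasCompactSupport hvs.norm).mul_prod
    (hρi.const_mul C)).mono' ?_ (.of_forall fun p => ?_)
  · exact (Continuous.aestronglyMeasurable (by fun_prop)).mul
      (AEStronglyMeasurable.inner (Continuous.aestronglyMeasurable (by fun_prop)) hk)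
  · rw [norm_mul]
    calc ‖u p.1 - u (p.1 - p.2)‖ * ‖⟪v p.1, nlKer ρ p.2⟫_ℝ‖
        ≤ ‖u p.1 - u (p.1 - p.2)‖ * (‖v p.1‖ * ‖nlKer ρ p.2‖) := by
          gcongr; exact norm_inner_le_norm _ _
      _ = ‖v p.1‖ * (‖u p.1 - u (p.1 - p.2)‖ * ‖nlKer ρ p.2‖) := by ring
      _ ≤ _ := mul_le_mul_of_nonneg_left (hC _ _) (norm_nonneg _)

theorem integrable_prod_mul_inner_sub_nlKer {ρ : Eu n → ℝ} (hρ : ∀ x, 0 ≤ ρ x)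
    (hρm : AEStronglyMeasurable ρ volume)
    (hρi : Integrable (fun x : Eu n => min 1 ‖x‖⁻¹ * ρ x) volume)
    {u : Eu n → ℝ} (hu : Continuous u) (hus : HasCompactSupport u)
    {v : Eu n → Eu n} (hv : ContDiff ℝ (⊤ : ℕ∞) v) (hvs : HasCompactSupport v) :
    Integrable (fun p : Eu n × Eu n => u p.1 * ⟪v p.1 - v (p.1 - p.2), nlKer ρ p.2⟫_ℝ)
      (volume.prod volume) := by
  obtain ⟨C, hC⟩ := exists_norm_sub_mul_norm_nlKer_le hρ hv hvs
  have hc := hv.continuous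
  have hk := (aestronglyMeasurable_nlKer hρm).comp_snd (μ := (volume : Measure (Eu n)))
  refine ((hu.norm.integrable_of_hasCompactSupport hus.norm).mul_prod
    (hρi.const_mul C)).mono' ?_ (.of_forall fun p => ?_)
  · exact (Continuous.aestronglyMeasurable (by fun_prop)).mul
      (AEStronglyMeasurable.inner (Continuous.aestronglyMeasurable (by fun_prop)) hk)
  · rw [norm_mul]
    gcongr
    exact (norm_inner_le_norm _ _).trans (hC _ _)

theorem nlGradS_eq_integral_nlKer (ρ u : Eu n → ℝ) (x : Eu n) :
    nlGradS ρ u x = ∫ z, (u x - u (x - z)) • nlKer ρ z := by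
  rw [nlGradS, ← integral_sub_left_eq_self _ volume x]
  simp [nlKer, smul_smul, mul_div_assoc]

theorem nlDivV_eq_integral_nlKer (ρ : Eu n → ℝ) (v : Eu n → Eu n) (x : Eu n) :
    nlDivV ρ v x = ∫ z, ⟪v x - v (x - z), nlKer ρ z⟫_ℝ := by
  rw [nlDivV, ← integral_sub_left_eq_self _ volume x]
  refine integral_congr_ae (.of_forall fun z => ?_)
  simp only [nlDivVInt, nlKer, sub_sub_cancel, real_inner_smul_right]
  ring

/-- For a fixed shift `z`, the gradient and divergence integrands agree up to translation by `z`,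
the change of sign of `z`, and a total difference. -/
theorem integral_mul_inner_nlKer_eq_neg {ρ : Eu n → ℝ} {ρb : ℝ → ℝ}
    (hρ : ∀ x : Eu n, x ≠ 0 → ρ x = ρb ‖x‖)
    {u : Eu n → ℝ} (hu : Continuous u) (hus : HasCompactSupport u)
    {v : Eu n → Eu n} (hv : Continuous v) (z : Eu n) :
    ∫ x, (u x - u (x - z)) * ⟪v x, nlKer ρ z⟫_ℝ =
      -∫ x, u x * ⟪v x - v (x - -z), nlKer ρ (-z)⟫_ℝ := by
  have hi : Integrable fun x => u x * ⟪v x, nlKer ρ z⟫_ℝ :=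
    Continuous.integrable_of_hasCompactSupport (by fun_prop) hus.mul_right
  have hj : Integrable fun x => u (x - z) * ⟪v x, nlKer ρ z⟫_ℝ :=
    Continuous.integrable_of_hasCompactSupport (by fun_prop)
      (HasCompactSupport.mul_right (hus.comp_homeomorph (Homeomorph.subRight z)))
  have hs : ∫ x, u x * ⟪v (x + z), nlKer ρ z⟫_ℝ = ∫ x, u (x - z) * ⟪v x, nlKer ρ z⟫_ℝ := by
    rw [← integral_sub_right_eq_self _ z]
    simp
  have hj' : Integrable fun x => u x * ⟪v (x + z), nlKer ρ z⟫_ℝ :=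
    Continuous.integrable_of_hasCompactSupport (by fun_prop) hus.mul_right
  simp only [nlKer_neg hρ, sub_neg_eq_add, inner_neg_right, inner_sub_left, mul_neg, mul_sub,
    sub_mul, integral_neg, neg_neg]
  rw [integral_sub hi hj, integral_sub hi hj', hs]

variable (n)

/-- nonlocal integration by parts formula. -/
theorem stmt11 (hn : 0 < n) (ρ : Eu n → ℝ) (ρb : ℝ → ℝ) (ε : ℝ)
    (h0 : IsKernelH0 n ρ ρb ε)
    (u : Eu n → ℝ) (hu : ContDiff ℝ (⊤ : ℕ∞) u) (hus : HasCompactSupport u)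
    (v : Eu n → Eu n) (hv : ContDiff ℝ (⊤ : ℕ∞) v) (hvs : HasCompactSupport v) :
    ∫ x, ⟪nlGradS ρ u x, v x⟫_ℝ = -∫ x, u x * nlDivV ρ v x := by
  obtain ⟨hρ, hrad, hloc, hint, -, -⟩ := h0
  have hρm := hloc.aestronglyMeasurable
  have hF := integrable_prod_mul_inner_nlKer hρ hρm hint hu hus hv.continuous hvs
  have hG := integrable_prod_mul_inner_sub_nlKer hρ hρm hint hu.continuous hus hv hvs
  calc ∫ x, ⟪nlGradS ρ u x, v x⟫_ℝ
      = ∫ x, ∫ z, (u x - u (x - z)) * ⟪v x, nlKer ρ z⟫_ℝ := by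
        refine integral_congr_ae (.of_forall fun x => ?_)
        simp only [nlGradS_eq_integral_nlKer, real_inner_comm (v x),
          ← integral_inner (integrable_smul_nlKer hρ hρm hint hu hus x), real_inner_smul_right]
    _ = ∫ z, ∫ x, (u x - u (x - z)) * ⟪v x, nlKer ρ z⟫_ℝ := integral_integral_swap hF
    _ = ∫ z, -∫ x, u x * ⟪v x - v (x - -z), nlKer ρ (-z)⟫_ℝ := by
        simp only [integral_mul_inner_nlKer_eq_neg hrad hu.continuous hus hv.continuous]
    _ = -∫ z, ∫ x, u x * ⟪v x - v (x - z), nlKer ρ z⟫_ℝ := by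
        rw [integral_neg,
          integral_neg_eq_self (fun z => ∫ x, u x * ⟪v x - v (x - z), nlKer ρ z⟫_ℝ)]
    _ = -∫ x, ∫ z, u x * ⟪v x - v (x - z), nlKer ρ z⟫_ℝ := by
        rw [← integral_integral_swap hG]
    _ = -∫ x, u x * nlDivV ρ v x := by
        simp only [nlDivV_eq_integral_nlKer, integral_const_mul]
end
end

section
/- Let ρ satisfy (H0). Then Q_ρ(x) := ∫_{|x|}^∞ ρ̄(t)/t dt is finite for a.e. x ≠ 0 and Q_ρ ∈ L¹_loc(ℝ^n), and for every u ∈ C_c^∞(ℝ^n) and every x ∈ ℝ^n, D_ρ u(x) = (Q_ρ * ∇u)(x) = ∇(Q_ρ * u)(x), where ∇u is the classical gradient and * denotes convolution (applied componentwise in the first identity). (Representation of the nonlocal gradient as a convolution.) -/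
open MeasureTheory Metric Set Matrix
open scoped ENNReal InnerProductSpace

noncomputable section

variable {n : ℕ}

variable (n)

section RadialKernels

open Module Filter Topology

/-- Radial profiles `k` for which `k(‖z‖) min(1, ‖z‖)` is integrable on a `d`-dimensional space,
expressed in polar coordinates. -/
def RadiallyAdmissible (d : ℕ) (k : ℝ → ℝ) : Prop :=
  IntegrableOn (fun t : ℝ => t ^ (d - 1) * (min 1 t * k t)) (Ioi 0)

lemma RadiallyAdmissible.aestronglyMeasurable {d : ℕ} {k : ℝ → ℝ} (hk : RadiallyAdmissible d k) :
    AEStronglyMeasurable k (volume.restrict (Ioi 0)) := by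
  have hm : Measurable fun t : ℝ => (t ^ (d - 1) * min 1 t)⁻¹ := by fun_prop
  refine (hm.aestronglyMeasurable.mul (Integrable.aestronglyMeasurable hk)).congr ?_
  filter_upwards [ae_restrict_mem measurableSet_Ioi] with t ht
  have ht : 0 < t := ht
  have : 0 < min 1 t := lt_min one_pos ht
  simp only [Pi.mul_apply]
  field_simp

lemma min_one_pow_le {d : ℕ} (hd : 0 < d) (t : ℝ) :
    min 1 (t ^ d) ≤ t ^ (d - 1) * min 1 t := by
  obtain ⟨m, rfl⟩ : ∃ m, d = m + 1 := ⟨d - 1, by omega⟩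
  rcases le_total t 1 with h | h
  · rw [min_eq_right h, Nat.add_sub_cancel, ← pow_succ]
    exact min_le_right _ _
  · rw [min_eq_left h, mul_one]
    exact (min_le_left _ _).trans (one_le_pow₀ h)

lemma RadiallyAdmissible.integrableOn_min_pow {d : ℕ} (hd : 0 < d) {k : ℝ → ℝ}
    (hk : RadiallyAdmissible d k) :
    IntegrableOn (fun t : ℝ => min 1 (t ^ d) * k t) (Ioi 0) := by
  have hm : Measurable fun t : ℝ => min 1 (t ^ d) := by fun_prop
  refine Integrable.mono hk (hm.aestronglyMeasurable.mul hk.aestronglyMeasurable) ?_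
  filter_upwards [ae_restrict_mem measurableSet_Ioi] with t ht
  have ht : 0 < t := ht
  have : 0 < min 1 t := lt_min one_pos ht
  have h2 : 0 < min 1 (t ^ d) := lt_min one_pos (by positivity)
  rw [← mul_assoc, norm_mul, norm_mul (_ * _), Real.norm_of_nonneg h2.le,
    Real.norm_of_nonneg (by positivity : 0 ≤ t ^ (d - 1) * min 1 t)]
  gcongr
  exact min_one_pow_le hd t

lemma RadiallyAdmissible.integrableOn_Ioi {d : ℕ} (hd : 0 < d) {k : ℝ → ℝ}
    (hk : RadiallyAdmissible d k) {r : ℝ} (hr : 0 < r) : IntegrableOn k (Ioi r) := by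
  have hsub : Ioi r ⊆ Ioi 0 := Ioi_subset_Ioi hr.le
  have hi := ((hk.integrableOn_min_pow hd).mono_set hsub).norm.const_mul (min 1 (r ^ d))⁻¹
  refine Integrable.mono' hi (hk.aestronglyMeasurable.mono_set hsub) ?_
  filter_upwards [ae_restrict_mem measurableSet_Ioi] with t ht
  have ht : r < t := ht
  have h0 : 0 < min 1 (r ^ d) := lt_min one_pos (by positivity)
  have h1 : min 1 (r ^ d) ≤ min 1 (t ^ d) := by gcongr
  rw [norm_mul, Real.norm_of_nonneg (h0.le.trans h1), inv_mul_eq_div, le_div_iff₀ h0, mul_comm]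
  gcongr

lemma radiallyAdmissible_of_continuous {d : ℕ} {k : ℝ → ℝ} (hk : Continuous k)
    (hc : HasCompactSupport k) : RadiallyAdmissible d k := by
  refine (Continuous.integrable_of_hasCompactSupport (by fun_prop) ?_).integrableOn
  exact (hc.mul_left).mul_left

lemma setIntegral_tail_indicator {E : Type*} [NormedAddCommGroup E] (k : ℝ → ℝ) (G : E → ℝ)
    (z : E) :
    ∫ t in Ioi 0, {p : E × ℝ | ‖p.1‖ < p.2}.indicator (fun p => G p.1 * k p.2) (z, t) =
      (∫ t in Ioi ‖z‖, k t) * G z := by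
  have h : (fun t => {p : E × ℝ | ‖p.1‖ < p.2}.indicator (fun p => G p.1 * k p.2) (z, t)) =
      (Ioi ‖z‖).indicator fun t => G z * k t := by
    ext t
    simp [indicator]
  rw [h, setIntegral_indicator measurableSet_Ioi, inter_eq_self_of_subset_right
    (Ioi_subset_Ioi (norm_nonneg z)), integral_const_mul, mul_comm]

lemma norm_inner_div_norm_le {E : Type*} [NormedAddCommGroup E] [InnerProductSpace ℝ E]
    (z v : E) : ‖⟪z, v⟫_ℝ / ‖z‖‖ ≤ ‖v‖ := by
  rw [norm_div, norm_norm]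
  exact div_le_of_le_mul₀ (norm_nonneg _) (norm_nonneg _)
    ((norm_inner_le_norm z v).trans_eq (mul_comm _ _))

/-- The tail integral of a test function is differentiable as a radial function. -/
lemma hasFDerivAt_tail_norm {E : Type*} [NormedAddCommGroup E]
    [InnerProductSpace ℝ E] {φ : ℝ → ℝ} (hφ : Continuous φ) (hc : HasCompactSupport φ)
    (hs : tsupport φ ⊆ Ioi 0) (z : E) :
    HasFDerivAt (fun z : E => ∫ t in Ioi ‖z‖, φ t) (-(φ ‖z‖ / ‖z‖) • innerSL ℝ z) z := by
  have hint : Integrable φ := hφ.integrable_of_hasCompactSupport hc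
  have heq : ∀ r, ∫ t in Ioi r, φ t = (∫ t in Ioi 0, φ t) - ∫ t in (0 : ℝ)..r, φ t := by
    intro r
    rw [← intervalIntegral.integral_Ioi_sub_Ioi' hint.integrableOn hint.integrableOn]
    ring
  have hder : ∀ r, HasDerivAt (fun r => ∫ t in Ioi r, φ t) (-φ r) r := by
    intro r
    rw [funext heq]
    exact (intervalIntegral.integral_hasDerivAt_right (hφ.intervalIntegrable _ _)
      (hφ.stronglyMeasurableAtFilter _ _) hφ.continuousAt).const_sub _
  by_cases hz : z = 0
  · subst hz
    have h0 : (0 : ℝ) ∉ tsupport φ := fun h => lt_irrefl (0 : ℝ) (hs h)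
    have hz : φ =ᶠ[𝓝 0] 0 := notMem_tsupport_iff_eventuallyEq.1 h0
    obtain ⟨δ, hδ, hφ0⟩ := Metric.eventually_nhds_iff_ball.1 hz
    have hconst : (fun z : E => ∫ t in Ioi ‖z‖, φ t) =ᶠ[𝓝 0] fun _ => ∫ t in Ioi 0, φ t := by
      filter_upwards [ball_mem_nhds (0 : E) hδ] with z hz
      rw [heq, intervalIntegral.integral_zero_ae, sub_zero]
      refine .of_forall fun t ht => hφ0 t ?_
      rw [uIoc_of_le (norm_nonneg z)] at ht
      simp only [mem_ball_zero_iff, Real.norm_eq_abs, abs_of_pos ht.1] at hz ⊢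
      exact ht.2.trans_lt hz
    simpa using (hasFDerivAt_const _ _).congr_of_eventuallyEq hconst
  · have hn : HasFDerivAt (fun z : E => ‖z‖) (‖z‖⁻¹ • innerSL ℝ z) z := by
      have h := (hasStrictFDerivAt_norm_sq z).hasFDerivAt.sqrt (by simpa using hz)
      simp only [Real.sqrt_sq (norm_nonneg _)] at h
      convert h using 1
      ext w
      simp
      ring
    have hlin : -(φ ‖z‖ / ‖z‖) • innerSL ℝ z = -φ ‖z‖ • ‖z‖⁻¹ • innerSL ℝ z := by
      rw [smul_smul]
      congr 1
      ring
    rw [hlin]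
    exact (hder ‖z‖).comp_hasFDerivAt z hn

variable {E : Type*} [NormedAddCommGroup E] [InnerProductSpace ℝ E] [FiniteDimensional ℝ E]
  [MeasurableSpace E] [BorelSpace E]
  (μ : Measure E) [μ.IsAddHaarMeasure]

/-- Integrability over the region `‖z‖ < t` needed to exchange the tail integral of `k` with the
integral of `G`. -/
lemma RadiallyAdmissible.integrable_tail_prod [Nontrivial E] {k : ℝ → ℝ}
    (hk : RadiallyAdmissible (finrank ℝ E) k) {G : E → ℝ} (hG : Integrable G μ) {M : ℝ}
    (hM : ∀ z, ‖G z‖ ≤ M) :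
    Integrable ({p : E × ℝ | ‖p.1‖ < p.2}.indicator fun p => G p.1 * k p.2)
      (μ.prod (volume.restrict (Ioi 0))) := by
  have hd : 0 < finrank ℝ E := finrank_pos
  have hS : MeasurableSet {p : E × ℝ | ‖p.1‖ < p.2} :=
    (isOpen_lt (by fun_prop) (by fun_prop)).measurableSet
  have hM0 : 0 ≤ M := (norm_nonneg _).trans (hM 0)
  have hmeas : AEStronglyMeasurable ({p : E × ℝ | ‖p.1‖ < p.2}.indicator fun p => G p.1 * k p.2)
      (μ.prod (volume.restrict (Ioi 0))) :=
    (hG.aestronglyMeasurable.comp_fst.mul hk.aestronglyMeasurable.comp_snd).indicator hS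
  have hsec : ∀ t : ℝ, (fun z => ({p : E × ℝ | ‖p.1‖ < p.2}.indicator
      (fun p => G p.1 * k p.2)) (z, t)) = (ball (0 : E) t).indicator fun z => G z * k t := by
    intro t
    ext z
    simp [indicator]
  refine (integrable_prod_iff' hmeas).2 ⟨.of_forall fun t => ?_, ?_⟩
  · rw [hsec]
    exact (hG.mul_const _).indicator measurableSet_ball
  · set C : ℝ := max (∫ z, ‖G z‖ ∂μ) (M * μ.real (ball 0 1))
    refine Integrable.mono' ((hk.integrableOn_min_pow hd).norm.const_mul C)
      hmeas.norm.prod_swap.integral_prod_right' ?_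
    filter_upwards [ae_restrict_mem measurableSet_Ioi] with t ht
    have ht : 0 < t := ht
    have h1 : ∀ z, ‖({p : E × ℝ | ‖p.1‖ < p.2}.indicator
        (fun p => G p.1 * k p.2)) (z, t)‖ =
        (ball (0 : E) t).indicator (fun z => ‖G z‖) z * ‖k t‖ := by
      intro z
      rw [congrFun (hsec t) z]
      by_cases hz : z ∈ ball (0 : E) t <;> simp [hz]
    have h0 : 0 ≤ ∫ z in ball (0 : E) t, ‖G z‖ ∂μ := by positivity
    have h2 : ∫ z in ball (0 : E) t, ‖G z‖ ∂μ ≤ ∫ z, ‖G z‖ ∂μ :=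
      setIntegral_le_integral hG.norm (.of_forall fun _ => norm_nonneg _)
    have h3 : ∫ z in ball (0 : E) t, ‖G z‖ ∂μ ≤ t ^ finrank ℝ E * (M * μ.real (ball 0 1)) := by
      calc _ ≤ ∫ z in ball (0 : E) t, M ∂μ :=
            setIntegral_mono hG.norm.integrableOn (by simp [measure_ball_lt_top])
              fun z => hM z
        _ = _ := by
          rw [setIntegral_const, measureReal_def, Measure.addHaar_ball μ 0 ht.le, ENNReal.toReal_mul,
            ENNReal.toReal_ofReal (by positivity), smul_eq_mul, measureReal_def]
          ring
    have h4 : 0 ≤ M * μ.real (ball (0 : E) 1) := by positivity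
    simp_rw [h1]
    rw [integral_mul_const, integral_indicator measurableSet_ball, norm_mul, norm_norm,
      Real.norm_of_nonneg h0, norm_mul, ← mul_assoc,
      Real.norm_of_nonneg (le_min zero_le_one (by positivity))]
    gcongr
    rcases le_total 1 (t ^ finrank ℝ E) with h | h
    · rw [min_eq_left h, mul_one]
      exact h2.trans (le_max_left _ _)
    · rw [min_eq_right h, mul_comm]
      exact h3.trans (by gcongr; exact le_max_right _ _)

lemma RadiallyAdmissible.integrable_tail_mul [Nontrivial E] {k : ℝ → ℝ}
    (hk : RadiallyAdmissible (finrank ℝ E) k) {G : E → ℝ} (hG : Integrable G μ) {M : ℝ}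
    (hM : ∀ z, ‖G z‖ ≤ M) : Integrable (fun z => (∫ t in Ioi ‖z‖, k t) * G z) μ := by
  simpa only [setIntegral_tail_indicator] using
    (hk.integrable_tail_prod μ hG hM).integral_prod_left

/-- The layer-cake formula for a radial tail integral. -/
lemma RadiallyAdmissible.integral_tail_mul [Nontrivial E] {k : ℝ → ℝ}
    (hk : RadiallyAdmissible (finrank ℝ E) k) {G : E → ℝ} (hG : Integrable G μ) {M : ℝ}
    (hM : ∀ z, ‖G z‖ ≤ M) :
    ∫ z, (∫ t in Ioi ‖z‖, k t) * G z ∂μ = ∫ t in Ioi 0, k t * ∫ z in ball 0 t, G z ∂μ := by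
  simp_rw [← setIntegral_tail_indicator]
  rw [integral_integral_swap (f := fun z t =>
    {p : E × ℝ | ‖p.1‖ < p.2}.indicator (fun p => G p.1 * k p.2) (z, t))
    (hk.integrable_tail_prod μ hG hM)]
  congr 1
  ext t
  rw [← integral_indicator measurableSet_ball, ← integral_const_mul]
  congr 1
  ext z
  by_cases hz : ‖z‖ < t <;> simp [indicator, hz, mul_comm]

/-- Integration in polar coordinates. -/
lemma integral_eq_integral_Ioi_sphere [Nontrivial E] {f : E → ℝ} (hf : Integrable f μ) :
    ∫ z, f z ∂μ = ∫ t in Ioi (0 : ℝ), t ^ (finrank ℝ E - 1) *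
      ∫ ω : sphere (0 : E) 1, f (t • (ω : E)) ∂μ.toSphere := by
  have hmp := μ.measurePreserving_homeomorphUnitSphereProd
  have hme := (homeomorphUnitSphereProd E).measurableEmbedding
  set F : sphere (0 : E) 1 × Ioi (0 : ℝ) → ℝ := fun p => f ((p.2 : ℝ) • (p.1 : E)) with hF
  have hcomp : ∀ z : ({0}ᶜ : Set E), F (homeomorphUnitSphereProd E z) = f z := by
    rintro ⟨z, hz⟩
    have : ‖z‖ ≠ 0 := by simpa using hz
    simp [hF, smul_smul, this]
  have hFi : Integrable F (μ.toSphere.prod (.volumeIoiPow (finrank ℝ E - 1))) := by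
    rw [← hmp.integrable_comp_emb hme]
    have : F ∘ homeomorphUnitSphereProd E = f ∘ Subtype.val := funext hcomp
    rw [this, ← integrableOn_iff_comap_subtypeVal (measurableSet_singleton _).compl]
    exact hf.integrableOn
  calc ∫ z, f z ∂μ = ∫ z : ({0}ᶜ : Set E), f z ∂(μ.comap (↑)) := by
        rw [integral_subtype_comap (measurableSet_singleton _).compl f, restrict_compl_singleton]
    _ = ∫ p, F p ∂μ.toSphere.prod (.volumeIoiPow (finrank ℝ E - 1)) := by
        rw [← hmp.integral_comp hme]
        simp_rw [hcomp]
    _ = ∫ t : Ioi (0 : ℝ), (∫ ω : sphere (0 : E) 1, f ((t : ℝ) • (ω : E)) ∂μ.toSphere)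
          ∂.volumeIoiPow (finrank ℝ E - 1) := integral_prod_symm _ hFi
    _ = _ := by
      simp only [Measure.volumeIoiPow, ENNReal.ofReal]
      rw [integral_withDensity_eq_integral_smul,
        integral_subtype_comap measurableSet_Ioi fun t : ℝ => Real.toNNReal (t ^ (finrank ℝ E - 1)) •
          ∫ ω : sphere (0 : E) 1, f (t • (ω : E)) ∂μ.toSphere,
        setIntegral_congr_fun measurableSet_Ioi fun t ht => ?_]
      · rw [NNReal.smul_def, Real.coe_toNNReal _ (pow_nonneg ht.out.le _), smul_eq_mul]
      · exact (measurable_subtype_coe.pow_const _).real_toNNReal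

lemma RadiallyAdmissible.integrable_mul_of_le_min [Nontrivial E] {k : ℝ → ℝ}
    (hk : RadiallyAdmissible (finrank ℝ E) k) {f : E → ℝ} (hf : AEStronglyMeasurable f μ) {C : ℝ}
    (hC : ∀ z, ‖f z‖ ≤ C * min 1 ‖z‖) : Integrable (fun z => k ‖z‖ * f z) μ := by
  have hi : Integrable (fun z : E => min 1 ‖z‖ * k ‖z‖) μ :=
    (integrable_fun_norm_addHaar μ (f := fun t => min 1 t * k t)).2 hk
  have hm : Measurable fun z : E => (min 1 ‖z‖)⁻¹ := by fun_prop
  refine Integrable.mono' (hi.norm.const_mul C)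
    (((hm.aestronglyMeasurable.mul hi.aestronglyMeasurable).mul hf).congr ?_)
    (.of_forall fun z => ?_)
  · filter_upwards [Measure.ae_ne μ 0] with z hz
    have : 0 < min 1 ‖z‖ := lt_min one_pos (norm_pos_iff.2 hz)
    simp only [Pi.mul_apply]
    field_simp
  · rw [norm_mul, norm_mul, Real.norm_of_nonneg (le_min zero_le_one (norm_nonneg z)),
      ← mul_assoc, mul_comm]
    gcongr
    exact hC z

/-- A radial kernel integrated against a function with the right decay, in polar coordinates. -/
lemma RadiallyAdmissible.integral_mul_inner_mul [Nontrivial E] {k : ℝ → ℝ}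
    (hk : RadiallyAdmissible (finrank ℝ E) k) {g : E → ℝ} (hg : Continuous g) {C : ℝ}
    (hC : ∀ z, ‖g z‖ ≤ C * min 1 ‖z‖) (v : E) :
    Integrable (fun z => k ‖z‖ * (⟪z, v⟫_ℝ / ‖z‖ * g z)) μ ∧
    ∫ z, k ‖z‖ * (⟪z, v⟫_ℝ / ‖z‖ * g z) ∂μ = ∫ t in Ioi (0 : ℝ), k t * (t ^ (finrank ℝ E - 1) *
      ∫ ω : sphere (0 : E) 1, ⟪(ω : E), v⟫_ℝ * g (t • (ω : E)) ∂μ.toSphere) := by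
  have hi : Integrable (fun z => k ‖z‖ * (⟪z, v⟫_ℝ / ‖z‖ * g z)) μ := by
    refine hk.integrable_mul_of_le_min μ (C := ‖v‖ * C) ?_ fun z => ?_
    · have : Measurable fun z : E => ⟪z, v⟫_ℝ / ‖z‖ :=
        (by fun_prop : Continuous fun z : E => ⟪z, v⟫_ℝ).measurable.div measurable_norm
      exact (this.mul hg.measurable).aestronglyMeasurable
    · rw [norm_mul, mul_assoc]
      gcongr
      · exact norm_inner_div_norm_le z v
      · exact hC z
  refine ⟨hi, ?_⟩
  rw [integral_eq_integral_Ioi_sphere μ hi]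
  refine setIntegral_congr_fun measurableSet_Ioi fun t ht => ?_
  have ht : 0 < t := ht
  have h : ∀ ω : sphere (0 : E) 1, k ‖t • (ω : E)‖ * (⟪t • (ω : E), v⟫_ℝ / ‖t • (ω : E)‖ *
      g (t • (ω : E))) = k t * (⟪(ω : E), v⟫_ℝ * g (t • (ω : E))) := by
    intro ω
    have : ‖t • (ω : E)‖ = t := by simp [norm_smul, abs_of_pos ht]
    rw [this, real_inner_smul_left]
    field_simp
  simp only [h, integral_const_mul]
  ring

/-- Integration by parts for a radial test function. -/
lemma integral_tail_mul_fderiv_of_test [Nontrivial E] {φ : ℝ → ℝ} (hφ : Continuous φ)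
    (hc : HasCompactSupport φ) (hs : tsupport φ ⊆ Ioi 0) {g : E → ℝ} (hg : ContDiff ℝ 1 g) {C : ℝ}
    (hC : ∀ z, ‖g z‖ ≤ C * min 1 ‖z‖) (v : E) :
    ∫ z, (∫ t in Ioi ‖z‖, φ t) * fderiv ℝ g z v ∂μ =
      ∫ z, φ ‖z‖ * (⟪z, v⟫_ℝ / ‖z‖ * g z) ∂μ := by
  have hder := hasFDerivAt_tail_norm (E := E) hφ hc hs
  have hdiff : Differentiable ℝ fun z : E => ∫ t in Ioi ‖z‖, φ t :=
    fun z => (hder z).differentiableAt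
  have hsupp : HasCompactSupport fun z : E => ∫ t in Ioi ‖z‖, φ t := by
    obtain ⟨R, hR⟩ := hc.isCompact.isBounded.subset_closedBall (0 : ℝ)
    refine HasCompactSupport.intro (isCompact_closedBall (0 : E) R) fun z hz => ?_
    refine setIntegral_eq_zero_of_forall_eq_zero fun t ht => ?_
    refine image_eq_zero_of_notMem_tsupport fun h => hz ?_
    have h1 := hR h
    simp only [mem_closedBall_zero_iff, Real.norm_eq_abs] at h1 ⊢
    exact (ht.out.le.trans (le_abs_self t)).trans h1
  have hfd : ∀ z, fderiv ℝ (fun z : E => ∫ t in Ioi ‖z‖, φ t) z v * g z =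
      -(φ ‖z‖ * (⟪z, v⟫_ℝ / ‖z‖ * g z)) := by
    intro z
    rw [(hder z).fderiv]
    simp
    ring
  have hcg : Continuous fun z => fderiv ℝ g z v :=
    (hg.continuous_fderiv one_ne_zero).clm_apply continuous_const
  rw [integral_mul_fderiv_eq_neg_fderiv_mul_of_integrable]
  · simp_rw [hfd, integral_neg, neg_neg]
  · simp_rw [hfd]
    exact ((radiallyAdmissible_of_continuous hφ hc).integral_mul_inner_mul μ
      hg.continuous hC v).1.neg
  · exact (hdiff.continuous.mul hcg).integrable_of_hasCompactSupport hsupp.mul_right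
  · exact (hdiff.continuous.mul hg.continuous).integrable_of_hasCompactSupport hsupp.mul_right
  · exact fun z _ => hdiff z
  · exact fun z _ => hg.differentiable one_ne_zero z

lemma locallyIntegrable_setIntegral_ball {G : E → ℝ} (hG : Continuous G) (hGi : Integrable G μ) :
    LocallyIntegrable fun t : ℝ => ∫ z in ball 0 t, G z ∂μ := by
  have hS : MeasurableSet {p : ℝ × E | ‖p.2‖ < p.1} :=
    (isOpen_lt (by fun_prop) (by fun_prop)).measurableSet
  have hm : StronglyMeasurable fun t : ℝ => ∫ z in ball 0 t, G z ∂μ := by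
    have h := ((hG.comp continuous_snd).stronglyMeasurable.indicator hS).integral_prod_right'
      (ν := μ)
    convert h using 2 with t
    rw [← integral_indicator measurableSet_ball]
    congr 1
    ext z
    simp [indicator]
  refine (locallyIntegrable_const (∫ z, ‖G z‖ ∂μ)).mono hm.aestronglyMeasurable
    (.of_forall fun t => ?_)
  calc ‖∫ z in ball 0 t, G z ∂μ‖ ≤ ∫ z in ball 0 t, ‖G z‖ ∂μ := norm_integral_le_integral_norm _
    _ ≤ ∫ z, ‖G z‖ ∂μ := setIntegral_le_integral hGi.norm (.of_forall fun _ => norm_nonneg _)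
    _ ≤ _ := le_abs_self _

/-- The divergence theorem on almost every ball. -/
lemma ae_setIntegral_ball_fderiv_eq [Nontrivial E] {g : E → ℝ} (hg : ContDiff ℝ 1 g)
    (hg' : HasCompactSupport (fderiv ℝ g)) {C : ℝ} (hC : ∀ z, ‖g z‖ ≤ C * min 1 ‖z‖) (v : E) :
    ∀ᵐ t : ℝ, t ∈ Ioi (0 : ℝ) → ∫ z in ball 0 t, fderiv ℝ g z v ∂μ = t ^ (finrank ℝ E - 1) *
      ∫ ω : sphere (0 : E) 1, ⟪(ω : E), v⟫_ℝ * g (t • (ω : E)) ∂μ.toSphere := by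
  have hcg : Continuous fun z => fderiv ℝ g z v :=
    (hg.continuous_fderiv one_ne_zero).clm_apply continuous_const
  have hsg : HasCompactSupport fun z => fderiv ℝ g z v :=
    hg'.comp_left (g := fun L : E →L[ℝ] ℝ => L v) rfl
  have hig : Integrable (fun z => fderiv ℝ g z v) μ := hcg.integrable_of_hasCompactSupport hsg
  obtain ⟨M, hM⟩ := hcg.bounded_above_of_compact_support hsg
  have hA := locallyIntegrable_setIntegral_ball μ hcg hig
  have hB : LocallyIntegrable fun t : ℝ => t ^ (finrank ℝ E - 1) *
      ∫ ω : sphere (0 : E) 1, ⟪(ω : E), v⟫_ℝ * g (t • (ω : E)) ∂μ.toSphere := by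
    have hgc := hg.continuous
    have h := continuous_parametric_integral_of_continuous (μ := μ.toSphere)
      (f := fun (t : ℝ) (ω : sphere (0 : E) 1) => ⟪(ω : E), v⟫_ℝ * g (t • (ω : E)))
      (by fun_prop) isCompact_univ
    simp only [Measure.restrict_univ] at h
    exact (by fun_prop : Continuous _).locallyIntegrable
  have h := isOpen_Ioi.ae_eq_zero_of_integral_contDiff_smul_eq_zero (U := Ioi (0 : ℝ))
    ((hA.sub hB).locallyIntegrableOn _) fun φ hφ hc hs => ?_
  · filter_upwards [h] with t ht ht0
    exact sub_eq_zero.1 (ht ht0)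
  · have hφc := hφ.continuous
    have hk : RadiallyAdmissible (finrank ℝ E) φ := radiallyAdmissible_of_continuous hφc hc
    have hres : ∀ F : ℝ → ℝ, ∫ t, φ t * F t = ∫ t in Ioi 0, φ t * F t := by
      refine fun F => (setIntegral_eq_integral_of_forall_compl_eq_zero fun t ht => ?_).symm
      rw [image_eq_zero_of_notMem_tsupport fun h => ht (hs h), zero_mul]
    simp only [Pi.sub_apply, smul_sub]
    rw [integral_sub (hA.integrable_smul_left_of_hasCompactSupport hφc hc)
      (hB.integrable_smul_left_of_hasCompactSupport hφc hc), sub_eq_zero]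
    simp only [smul_eq_mul]
    rw [hres, hres, ← hk.integral_tail_mul μ hig hM,
      ← (hk.integral_mul_inner_mul μ hg.continuous hC v).2]
    exact integral_tail_mul_fderiv_of_test μ hφc hc hs hg hC v

/-- Integration by parts against an admissible radial kernel. -/
lemma RadiallyAdmissible.integral_tail_mul_fderiv [Nontrivial E] {k : ℝ → ℝ}
    (hk : RadiallyAdmissible (finrank ℝ E) k) {g : E → ℝ} (hg : ContDiff ℝ 1 g)
    (hg' : HasCompactSupport (fderiv ℝ g)) {C : ℝ} (hC : ∀ z, ‖g z‖ ≤ C * min 1 ‖z‖) (v : E) :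
    ∫ z, (∫ t in Ioi ‖z‖, k t) * fderiv ℝ g z v ∂μ =
      ∫ z, k ‖z‖ * (⟪z, v⟫_ℝ / ‖z‖ * g z) ∂μ := by
  have hcg : Continuous fun z => fderiv ℝ g z v :=
    (hg.continuous_fderiv one_ne_zero).clm_apply continuous_const
  have hsg : HasCompactSupport fun z => fderiv ℝ g z v :=
    hg'.comp_left (g := fun L : E →L[ℝ] ℝ => L v) rfl
  obtain ⟨M, hM⟩ := hcg.bounded_above_of_compact_support hsg
  rw [hk.integral_tail_mul μ (hcg.integrable_of_hasCompactSupport hsg) hM,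
    (hk.integral_mul_inner_mul μ hg.continuous hC v).2]
  refine setIntegral_congr_ae measurableSet_Ioi ?_
  filter_upwards [ae_setIntegral_ball_fderiv_eq μ hg hg' hC v] with t ht ht0
  rw [ht ht0]

lemma RadiallyAdmissible.locallyIntegrable_tail [Nontrivial E] {k : ℝ → ℝ}
    (hk : RadiallyAdmissible (finrank ℝ E) k) :
    LocallyIntegrable (fun z : E => ∫ t in Ioi ‖z‖, k t) μ := by
  refine locallyIntegrable_iff.2 fun K hK => ?_
  have hG : Integrable (K.indicator fun _ => (1 : ℝ)) μ :=
    (integrable_indicator_iff hK.measurableSet).2 (by simp [hK.measure_lt_top])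
  have h := hk.integrable_tail_mul μ hG (M := 1) fun z =>
    (norm_indicator_le_norm_self _ _).trans (by simp)
  rw [← integrable_indicator_iff hK.measurableSet]
  refine h.congr (.of_forall fun z => ?_)
  by_cases hz : z ∈ K <;> simp [hz]

end RadialKernels

section NonlocalGradient

open Module

variable {n}

lemma IsKernelH0.radiallyAdmissible (hn : 0 < n) {ρ : Eu n → ℝ} {ρb : ℝ → ℝ} {ε : ℝ}
    (h0 : IsKernelH0 n ρ ρb ε) :
    RadiallyAdmissible (finrank ℝ (Eu n)) fun t => ρb t / t := by
  have : Nonempty (Fin n) := ⟨⟨0, hn⟩⟩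
  obtain ⟨-, hrad, -, hint, -⟩ := h0
  refine (integrable_fun_norm_addHaar (volume : Measure (Eu n))
    (f := fun t => min 1 t * (ρb t / t))).1 (hint.congr ?_)
  filter_upwards [Measure.ae_ne volume 0] with z hz
  have hz' : 0 < ‖z‖ := norm_pos_iff.2 hz
  rw [hrad z hz]
  rcases le_total ‖z‖ 1 with h | h
  · rw [min_eq_left ((one_le_inv₀ hz').2 h), min_eq_right h]
    field_simp
  · rw [min_eq_right (inv_le_one_of_one_le₀ h), min_eq_left h]
    field_simp

lemma exists_norm_sub_le_min {E : Type*} [NormedAddCommGroup E] [NormedSpace ℝ E] {u : E → ℝ}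
    (hu : ContDiff ℝ 1 u) (hc : HasCompactSupport u) (x : E) :
    ∃ C, ∀ z, ‖u x - u (x - z)‖ ≤ C * min 1 ‖z‖ := by
  obtain ⟨L, hL⟩ := hu.lipschitzWith_of_hasCompactSupport hc one_ne_zero
  obtain ⟨M, hM⟩ := hu.continuous.bounded_above_of_compact_support hc
  have hM0 : 0 ≤ M := (norm_nonneg _).trans (hM 0)
  refine ⟨max (2 * M) L, fun z => ?_⟩
  rcases le_total 1 ‖z‖ with h | h
  · rw [min_eq_left h, mul_one]
    refine (norm_sub_le _ _).trans (le_trans ?_ (le_max_left _ _))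
    linarith [hM x, hM (x - z)]
  · rw [min_eq_right h]
    refine (hL.norm_sub_le _ _).trans ?_
    rw [sub_sub_cancel]
    gcongr
    exact le_max_right _ _

/-- Directional form of the convolution representation of the nonlocal gradient. -/
lemma inner_nlGradS_eq (hn : 0 < n) {ρ : Eu n → ℝ} {ρb : ℝ → ℝ} {ε : ℝ}
    (h0 : IsKernelH0 n ρ ρb ε) {u : Eu n → ℝ} (hu : ContDiff ℝ 1 u) (hc : HasCompactSupport u)
    (x v : Eu n) :
    ⟪nlGradS ρ u x, v⟫_ℝ = ∫ z, Qker n ρb z * fderiv ℝ u (x - z) v := by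
  have : Nonempty (Fin n) := ⟨⟨0, hn⟩⟩
  have hk := h0.radiallyAdmissible hn
  obtain ⟨C, hC⟩ := exists_norm_sub_le_min hu hc x
  have hgd : ContDiff ℝ 1 fun z => u x - u (x - z) := by fun_prop
  have hfd : ∀ z, fderiv ℝ (fun z => u x - u (x - z)) z = fderiv ℝ u (x - z) := by
    intro z
    have h := ((hu.differentiable one_ne_zero (x - z)).hasFDerivAt.comp z
      ((hasFDerivAt_id z).const_sub x)).const_sub (u x)
    refine h.fderiv.trans ?_
    ext w
    simp
  have hsupp : HasCompactSupport (fderiv ℝ fun z => u x - u (x - z)) := by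
    rw [funext hfd]
    exact (hc.fderiv ℝ).comp_homeomorph (Homeomorph.subLeft x)
  have hmain := hk.integral_tail_mul_fderiv volume hgd hsupp hC v
  simp only [hfd] at hmain
  have hae : (fun z => (ρb ‖z‖ / ‖z‖ * (u x - u (x - z))) • (‖z‖⁻¹ • z)) =ᵐ[volume]
      fun z => ((u x - u (x - z)) * ρ z / ‖z‖ ^ 2) • z := by
    filter_upwards [Measure.ae_ne volume 0] with z hz
    rw [h0.2.1 z hz, smul_smul]
    congr 1
    ring
  have hint : Integrable fun z => ((u x - u (x - z)) * ρ z / ‖z‖ ^ 2) • z := by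
    have hi := hk.integrable_mul_of_le_min volume hgd.continuous.aestronglyMeasurable hC
    have hm : Measurable fun z : Eu n => ‖z‖⁻¹ • z := by fun_prop
    refine Integrable.congr (hi.mono (hi.aestronglyMeasurable.smul hm.aestronglyMeasurable)
      (.of_forall fun z => ?_)) hae
    rw [Pi.smul_apply', norm_smul, norm_smul, norm_inv, norm_norm]
    exact mul_le_of_le_one_right (norm_nonneg _) (inv_mul_le_one_of_le₀ le_rfl (norm_nonneg _))
  have hcv : nlGradS ρ u x = ∫ z, ((u x - u (x - z)) * ρ z / ‖z‖ ^ 2) • z := by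
    rw [nlGradS, ← integral_sub_left_eq_self _ volume x]
    simp only [sub_sub_cancel]
  rw [hcv, real_inner_comm, ← integral_inner hint]
  refine Eq.trans (integral_congr_ae ?_) hmain.symm
  filter_upwards [hae] with z hz
  rw [← hz, real_inner_smul_right, real_inner_smul_right, real_inner_comm]
  ring

end NonlocalGradient

/-- representation of the nonlocal gradient as a convolution. -/
theorem stmt12 (hn : 0 < n) (ρ : Eu n → ℝ) (ρb : ℝ → ℝ) (ε : ℝ)
    (h0 : IsKernelH0 n ρ ρb ε) :
    (∀ᵐ x : Eu n, x ≠ 0 → IntegrableOn (fun t => ρb t / t) (Ioi ‖x‖) volume) ∧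
    LocallyIntegrable (Qker n ρb) volume ∧
    ∀ u : Eu n → ℝ, ContDiff ℝ (⊤ : ℕ∞) u → HasCompactSupport u → ∀ x : Eu n,
      nlGradS ρ u x = ∫ y, Qker n ρb (x - y) • gradient u y ∧
      nlGradS ρ u x = gradient (fun z => ∫ y, Qker n ρb (z - y) * u y) x := by
  have : Nonempty (Fin n) := ⟨⟨0, hn⟩⟩
  have hk := h0.radiallyAdmissible hn
  have hQ : LocallyIntegrable (Qker n ρb) volume := hk.locallyIntegrable_tail volume
  refine ⟨.of_forall fun x hx => hk.integrableOn_Ioi Module.finrank_pos (norm_pos_iff.2 hx), hQ,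
    fun u hu hc x => ?_⟩
  have hu1 : ContDiff ℝ 1 u := hu.of_le (by exact_mod_cast le_top)
  have hgrad : ∀ y v, ⟪gradient u y, v⟫_ℝ = fderiv ℝ u y v := fun y v => by
    simp [gradient]
  constructor
  · have hgc : Continuous (gradient u) :=
      (InnerProductSpace.toDual ℝ (Eu n)).symm.continuous.comp
        (hu1.continuous_fderiv one_ne_zero)
    have hgs : HasCompactSupport (gradient u) :=
      (hc.fderiv ℝ).comp_left (map_zero (InnerProductSpace.toDual ℝ (Eu n)).symm)
    have hint : Integrable fun y => Qker n ρb (x - y) • gradient u y := by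
      have h := (hgs.convolutionExists_right (ContinuousLinearMap.lsmul ℝ ℝ) hQ hgc x)
      simpa using h.integrable.comp_sub_left x
    refine ext_inner_right ℝ fun v => ?_
    rw [inner_nlGradS_eq hn h0 hu1 hc, real_inner_comm, ← integral_inner hint,
      ← integral_sub_left_eq_self _ volume x]
    simp only [sub_sub_cancel, real_inner_smul_right, real_inner_comm (gradient u _) v, hgrad]
  · have hconv : (fun z => ∫ y, Qker n ρb (z - y) * u y) =
        convolution (Qker n ρb) u (ContinuousLinearMap.mul ℝ ℝ) volume := by
      ext z
      rw [convolution, ← integral_sub_left_eq_self _ volume z]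
      simp
    have hd := hc.hasFDerivAt_convolution_right (ContinuousLinearMap.mul ℝ ℝ) hQ hu1 x
    refine ext_inner_right ℝ fun v => ?_
    rw [inner_nlGradS_eq hn h0 hu1 hc, hconv, gradient, hd.fderiv,
      InnerProductSpace.toDual_symm_apply, convolution_precompR_apply _ hQ (hc.fderiv ℝ)
        (hu1.continuous_fderiv one_ne_zero)]
    simp [convolution]
end
end

section
/- Let ρ satisfy (H0) and have compact support (so Q_ρ ∈ L¹(ℝ^n)). Then for every ξ ∈ ℝ^n \ {0}, 𝓕(Q_ρ)(ξ) = (1/(2π|ξ|)) ∫_{ℝ^n} (ρ(x) x₁ / |x|²) sin(2π |ξ| x₁) dx, where x₁ denotes the first coordinate of x and 𝓕(f)(ξ) = ∫_{ℝ^n} f(x) e^{−2πi x·ξ} dx. -/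
open MeasureTheory Metric Set Matrix
open scoped ENNReal InnerProductSpace

noncomputable section

variable {n : ℕ}

/-- A function is radial if its value only depends on the norm. -/
def IsRadialFun (ρ : Eu n → ℝ) : Prop := ∀ x y : Eu n, ‖x‖ = ‖y‖ → ρ x = ρ y

lemma IsRadialFun.integral_comp_isometry {F : Type*} [NormedAddCommGroup F] [NormedSpace ℝ F]
    {ρ : Eu n → ℝ} (hr : IsRadialFun ρ) (T : Eu n ≃ₗᵢ[ℝ] Eu n) (g : Eu n → F) :
    ∫ x, ρ x • g (T x) = ∫ x, ρ x • g x := by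
  rw [← T.measurePreserving.integral_comp T.toHomeomorph.measurableEmbedding
    (fun x => ρ x • g x)]
  refine integral_congr_ae (ae_of_all _ fun x => ?_)
  simp only [hr (T x) x (T.norm_map x)]

lemma IsRadialFun.integral_inner_eq {F : Type*} [NormedAddCommGroup F] [NormedSpace ℝ F]
    {ρ : Eu n → ℝ} (hr : IsRadialFun ρ) {v w : Eu n} (h : ‖v‖ = ‖w‖) (g : ℝ → F) :
    ∫ x, ρ x • g ⟪x, v⟫_ℝ = ∫ x, ρ x • g ⟪x, w⟫_ℝ := by
  have hT := Submodule.reflection_sub h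
  set T := (ℝ ∙ (v - w))ᗮ.reflection
  rw [← hr.integral_comp_isometry T (fun x => g ⟪x, w⟫_ℝ)]
  refine integral_congr_ae (ae_of_all _ fun x => ?_)
  simp only [← hT, T.inner_map_map]

/-- The reflection that fixes `v` and flips `w` changes the sign of the integrand. -/
lemma IsRadialFun.integral_sin_inner_mul_inner_eq_zero {ρ : Eu n → ℝ} (hr : IsRadialFun ρ)
    {v w : Eu n} (h : ⟪w, v⟫_ℝ = 0) :
    ∫ x, ρ x * (Real.sin ⟪x, v⟫_ℝ * ⟪x, w⟫_ℝ / ‖x‖ ^ 2) = 0 := by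
  have hw := Submodule.reflection_orthogonalComplement_singleton_eq_neg (𝕜 := ℝ) w
  have hv := Submodule.reflection_mem_subspace_eq_self (K := (ℝ ∙ w)ᗮ)
    (Submodule.mem_orthogonal_singleton_iff_inner_right.2 h)
  set T := (ℝ ∙ w)ᗮ.reflection
  have key := hr.integral_comp_isometry T
    (fun x => Real.sin ⟪x, v⟫_ℝ * ⟪x, w⟫_ℝ / ‖x‖ ^ 2)
  have hneg : ∀ x, ρ x • (Real.sin ⟪T x, v⟫_ℝ * ⟪T x, w⟫_ℝ / ‖T x‖ ^ 2) =
      -(ρ x * (Real.sin ⟪x, v⟫_ℝ * ⟪x, w⟫_ℝ / ‖x‖ ^ 2)) := fun x => by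
    have h1 : ⟪T x, v⟫_ℝ = ⟪x, v⟫_ℝ := by
      conv_lhs => rw [← hv]
      exact T.inner_map_map x v
    have h2 : ⟪T x, w⟫_ℝ = -⟪x, w⟫_ℝ := by
      have h3 := T.inner_map_map x w
      rw [hw, inner_neg_right] at h3
      linarith
    rw [h1, h2, T.norm_map, smul_eq_mul]
    ring
  simp only [hneg, integral_neg, smul_eq_mul] at key
  linarith

lemma abs_div_norm_sq_le {x : Eu n} {A C : ℝ} (hC : 0 ≤ C) (h : |A| ≤ C * ‖x‖ ^ 2) :
    |A / ‖x‖ ^ 2| ≤ C := by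
  rw [abs_div, abs_of_nonneg (sq_nonneg ‖x‖)]
  exact div_le_of_le_mul₀ (sq_nonneg _) hC h

lemma abs_coord_le_norm (x : Eu n) (i : Fin n) : |x i| ≤ ‖x‖ := PiLp.norm_apply_le x i

lemma abs_coord_mul_coord_le (x : Eu n) (i j : Fin n) : |x i * x j| ≤ ‖x‖ ^ 2 := by
  rw [abs_mul, sq]
  exact mul_le_mul (abs_coord_le_norm x i) (abs_coord_le_norm x j) (abs_nonneg _) (norm_nonneg _)

lemma abs_coord_mul_sin_le (x : Eu n) (i : Fin n) (a : ℝ) :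
    |x i * Real.sin (a * x i)| ≤ |a| * ‖x‖ ^ 2 := by
  have h1 : |Real.sin (a * x i)| ≤ |a| * |x i| := by
    rw [← abs_mul]; exact Real.abs_sin_le_abs
  have h2 := abs_coord_mul_coord_le x i i
  rw [abs_mul] at h2 ⊢
  nlinarith [mul_le_mul_of_nonneg_left h1 (abs_nonneg (x i)),
    mul_le_mul_of_nonneg_left h2 (abs_nonneg a)]

lemma integrable_mul_of_abs_le {ρ g : Eu n → ℝ} (hρ : Integrable ρ) (hg : Measurable g) {C : ℝ}
    (hC : ∀ x, |g x| ≤ C) : Integrable (fun x => ρ x * g x) :=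
  hρ.mul_bdd hg.aestronglyMeasurable (ae_of_all _ hC)

/-- Differentiation under the integral sign against an integrable weight, when the derivative of
the other factor is locally bounded. -/
lemma hasDerivAt_integral_mul {ρ : Eu n → ℝ} (hρ : Integrable ρ) {g g' : ℝ → Eu n → ℝ} {t C : ℝ}
    (hg : ∀ s, Measurable (g s)) (hg' : Measurable (g' t)) {C₀ : ℝ} (hC₀ : ∀ x, |g t x| ≤ C₀)
    (hC : ∀ s ∈ ball t 1, ∀ x, |g' s x| ≤ C)
    (hd : ∀ s x, HasDerivAt (fun u => g u x) (g' s x) s) :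
    HasDerivAt (fun s => ∫ x, ρ x * g s x) (∫ x, ρ x * g' t x) t := by
  refine (hasDerivAt_integral_of_dominated_loc_of_deriv_le (bound := fun x => |ρ x| * C)
    (F := fun s x => ρ x * g s x) (F' := fun s x => ρ x * g' s x) (ball_mem_nhds t one_pos)
    (.of_forall fun s => hρ.1.mul (hg s).aestronglyMeasurable)
    (integrable_mul_of_abs_le hρ (hg t) hC₀) (hρ.1.mul hg'.aestronglyMeasurable)
    (ae_of_all _ fun x s hs => ?_) (hρ.abs.mul_const C)
    (ae_of_all _ fun x s _ => (hd s x).const_mul _)).2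
  rw [Real.norm_eq_abs, abs_mul]
  exact mul_le_mul_of_nonneg_left (hC s hs x) (abs_nonneg _)

lemma IsRadialFun.integral_coord_sq_mul_cos {ρ : Eu n → ℝ} (hr : IsRadialFun ρ)
    (hρ : Integrable ρ) {i j : Fin n} (hij : j ≠ i) (a : ℝ) :
    ∫ x, ρ x * (x i * Real.sin (a * x i) / ‖x‖ ^ 2) =
      ∫ x, ρ x * (a * (x j ^ 2 * Real.cos (a * x i)) / ‖x‖ ^ 2) := by
  have hzero : ∀ b : ℝ, ∫ x : Eu n, ρ x *
      (Real.sin (a * x i + b * x j) * (a * x j - b * x i) / ‖x‖ ^ 2) = 0 := fun b => by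
    have := hr.integral_sin_inner_mul_inner_eq_zero
      (v := a • EuclideanSpace.single i 1 + b • EuclideanSpace.single j 1)
      (w := a • EuclideanSpace.single j 1 - b • EuclideanSpace.single i 1) (by
        simp [inner_add_right, inner_smul_right, inner_sub_left, inner_smul_left,
          EuclideanSpace.inner_single_left, hij, hij.symm]
        ring)
    simpa [inner_add_right, inner_smul_right, inner_sub_right,
      EuclideanSpace.inner_single_right] using this
  have hd := hasDerivAt_integral_mul hρ (t := 0) (C := 2 * (|a| + 1)) (C₀ := |a| * |a|)
    (g := fun b x => Real.sin (a * x i + b * x j) * (a * x j - b * x i) / ‖x‖ ^ 2)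
    (g' := fun b x => (Real.cos (a * x i + b * x j) * x j * (a * x j - b * x i) +
      Real.sin (a * x i + b * x j) * (-x i)) / ‖x‖ ^ 2)
    (fun s => by fun_prop) (by fun_prop) (fun x => ?_) (fun s hs x => ?_) (fun s x => ?_)
  · simp only [hzero] at hd
    have h1 := hd.unique (hasDerivAt_const _ _)
    simp only [zero_mul, add_zero, sub_zero] at h1
    rw [eq_comm, ← sub_eq_zero, ← integral_sub, ← h1]
    · refine integral_congr_ae (ae_of_all _ fun x => ?_)
      ring
    · refine integrable_mul_of_abs_le hρ (by fun_prop) (C := |a|) fun x => ?_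
      refine abs_div_norm_sq_le (abs_nonneg a) ?_
      rw [abs_mul, abs_mul]
      have h2 := abs_coord_mul_coord_le x j j
      rw [← sq] at h2
      exact mul_le_mul_of_nonneg_left (by
        nlinarith [Real.abs_cos_le_one (a * x i), abs_nonneg (x j ^ 2)]) (abs_nonneg _)
    · exact integrable_mul_of_abs_le hρ (by fun_prop) fun x =>
        abs_div_norm_sq_le (abs_nonneg a) (abs_coord_mul_sin_le x i a)
  · refine abs_div_norm_sq_le (by positivity) ?_
    simp only [zero_mul, add_zero, sub_zero]
    have h1 : |Real.sin (a * x i)| ≤ |a| * ‖x‖ := Real.abs_sin_le_abs.trans (by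
      rw [abs_mul]; exact mul_le_mul_of_nonneg_left (abs_coord_le_norm x i) (abs_nonneg _))
    have h2 : |a * x j| ≤ |a| * ‖x‖ := by
      rw [abs_mul]; exact mul_le_mul_of_nonneg_left (abs_coord_le_norm x j) (abs_nonneg _)
    rw [abs_mul]
    calc _ ≤ |a| * ‖x‖ * (|a| * ‖x‖) := mul_le_mul h1 h2 (abs_nonneg _) (by positivity)
      _ = _ := by ring
  · refine abs_div_norm_sq_le (by positivity) ?_
    have hs' : |s| ≤ 1 := by simpa using (mem_ball.1 hs).le
    have hi := abs_coord_le_norm x i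
    have hj := abs_coord_le_norm x j
    have h0 := norm_nonneg x
    have hlin : ∀ y z : ℝ, |y| ≤ ‖x‖ → |z| ≤ ‖x‖ → |a * y| + |s * z| ≤ (|a| + 1) * ‖x‖ := by
      intro y z hy hz
      rw [abs_mul, abs_mul]
      nlinarith [abs_nonneg a, abs_nonneg s, abs_nonneg z]
    have h1 : |a * x j - s * x i| ≤ (|a| + 1) * ‖x‖ := (abs_sub _ _).trans (hlin _ _ hj hi)
    have h2 : |Real.sin (a * x i + s * x j)| ≤ (|a| + 1) * ‖x‖ :=
      Real.abs_sin_le_abs.trans ((abs_add_le _ _).trans (hlin _ _ hi hj))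
    have h3 : |Real.cos (a * x i + s * x j) * x j| ≤ ‖x‖ := by
      rw [abs_mul]
      nlinarith [Real.abs_cos_le_one (a * x i + s * x j), abs_nonneg (x j)]
    refine (abs_add_le _ _).trans ?_
    rw [abs_mul _ (a * x j - s * x i), abs_mul _ (-x i), abs_neg]
    have h4 := mul_le_mul h3 h1 (abs_nonneg _) h0
    have h5 := mul_le_mul h2 hi (abs_nonneg _) (by positivity)
    nlinarith
  · have hA : HasDerivAt (fun u : ℝ => a * x i + u * x j) (x j) s := by
      simpa using ((hasDerivAt_id s).mul_const (x j)).const_add (a * x i)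
    have hB : HasDerivAt (fun u : ℝ => a * x j - u * x i) (-x i) s := by
      simpa using ((hasDerivAt_id s).mul_const (x i)).const_sub (a * x j)
    exact (hA.sin.mul hB).div_const _

lemma hasDerivAt_integral_coord_mul_sin {ρ : Eu n → ℝ} (hρ : Integrable ρ) (i : Fin n)
    (a u : ℝ) :
    HasDerivAt (fun u : ℝ => ∫ x : Eu n, ρ x * (x i * Real.sin (u * a * x i) / ‖x‖ ^ 2))
      (∫ x : Eu n, ρ x * (a * (x i ^ 2 * Real.cos (u * a * x i)) / ‖x‖ ^ 2)) u := by
  refine hasDerivAt_integral_mul hρ (C := |a|) (C₀ := |u * a|)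
    (g := fun u x => x i * Real.sin (u * a * x i) / ‖x‖ ^ 2)
    (g' := fun u x => a * (x i ^ 2 * Real.cos (u * a * x i)) / ‖x‖ ^ 2)
    (fun s => by fun_prop) (by fun_prop)
    (fun x => abs_div_norm_sq_le (abs_nonneg _) (abs_coord_mul_sin_le x i _))
    (fun s _ x => abs_div_norm_sq_le (abs_nonneg _) ?_) (fun s x => ?_)
  · rw [abs_mul, abs_mul]
    have h2 := abs_coord_mul_coord_le x i i
    rw [← sq] at h2
    exact mul_le_mul_of_nonneg_left (by
      nlinarith [Real.abs_cos_le_one (s * a * x i), abs_nonneg (x i ^ 2)]) (abs_nonneg _)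
  · have hA : HasDerivAt (fun u : ℝ => u * a * x i) (a * x i) s := by
      simpa using ((hasDerivAt_id s).mul_const a).mul_const (x i)
    refine ((hA.sin.const_mul (x i)).div_const _).congr_deriv ?_
    ring

/-- The divergence theorem on balls for `cos (u a xᵢ)`, integrated against a radial weight. -/
lemma IsRadialFun.integral_cos_coord {ρ : Eu n → ℝ} (hr : IsRadialFun ρ)
    (hρ : Integrable ρ) (i : Fin n) (a u : ℝ) :
    u * a * ∫ x, ρ x * Real.cos (u * a * x i) =
      ((n - 1 : ℕ) : ℝ) * (∫ x, ρ x * (x i * Real.sin (u * a * x i) / ‖x‖ ^ 2)) +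
      u * ∫ x, ρ x * (a * (x i ^ 2 * Real.cos (u * a * x i)) / ‖x‖ ^ 2) := by
  have hint : ∀ j : Fin n, Integrable
      (fun x => ρ x * (u * a * (x j ^ 2 * Real.cos (u * a * x i)) / ‖x‖ ^ 2)) := fun j => by
    refine integrable_mul_of_abs_le hρ (by fun_prop) (C := |u * a|) fun x => ?_
    refine abs_div_norm_sq_le (abs_nonneg _) ?_
    rw [abs_mul _ (x j ^ 2 * _), abs_mul (x j ^ 2)]
    have h2 := abs_coord_mul_coord_le x j j
    rw [← sq] at h2
    exact mul_le_mul_of_nonneg_left (by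
      nlinarith [Real.abs_cos_le_one (u * a * x i), abs_nonneg (x j ^ 2)]) (abs_nonneg _)
  have hsum : u * a * ∫ x, ρ x * Real.cos (u * a * x i) =
      ∑ j, ∫ x, ρ x * (u * a * (x j ^ 2 * Real.cos (u * a * x i)) / ‖x‖ ^ 2) := by
    rw [← integral_finsetSum _ fun j _ => hint j, ← integral_const_mul]
    have : Nonempty (Fin n) := ⟨i⟩
    have hne : ∀ᵐ x : Eu n, x ≠ 0 := by
      simp [ae_iff, measure_singleton]
    refine integral_congr_ae (hne.mono fun x hx => ?_)
    have hx' : ‖x‖ ^ 2 ≠ 0 := by simpa using hx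
    simp only []
    rw [← Finset.mul_sum, ← Finset.sum_div, ← Finset.mul_sum, ← Finset.sum_mul,
      ← EuclideanSpace.real_norm_sq_eq]
    field_simp
  rw [hsum, ← Finset.sum_erase_add _ _ (Finset.mem_univ i)]
  congr 1
  · rw [Finset.sum_congr rfl fun j hj =>
      (hr.integral_coord_sq_mul_cos hρ (Finset.ne_of_mem_erase hj) (u * a)).symm]
    simp
  · rw [← integral_const_mul]
    refine integral_congr_ae (ae_of_all _ fun x => ?_)
    ring

lemma IsRadialFun.intervalIntegral_pow_mul_integral_cos {ρ : Eu n → ℝ} (hr : IsRadialFun ρ)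
    (hρ : Integrable ρ) (hn : 0 < n) (i : Fin n) {a : ℝ} (ha : a ≠ 0) :
    ∫ u in (0 : ℝ)..1, u ^ (n - 1) * ∫ x, ρ x * Real.cos (u * a * x i) =
      1 / a * ∫ x, ρ x * (x i * Real.sin (a * x i) / ‖x‖ ^ 2) := by
  have hK := hasDerivAt_integral_coord_mul_sin hρ i a
  set K := fun u : ℝ => ∫ x : Eu n, ρ x * (x i * Real.sin (u * a * x i) / ‖x‖ ^ 2) with hKdef
  have hKc : Continuous K := continuous_iff_continuousAt.2 fun u => (hK u).continuousAt
  have hCc : Continuous fun u : ℝ => ∫ x, ρ x * Real.cos (u * a * x i) := by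
    refine continuous_of_dominated (bound := fun x => |ρ x|)
      (fun u => hρ.1.mul (by fun_prop)) (fun u => ae_of_all _ fun x => ?_) hρ.abs
      (ae_of_all _ fun x => by fun_prop)
    rw [Real.norm_eq_abs, abs_mul]
    exact mul_le_of_le_one_right (abs_nonneg _) (Real.abs_cos_le_one _)
  have key := intervalIntegral.integral_eq_sub_of_hasDerivAt_of_le (zero_le_one (α := ℝ))
    (f := fun u => 1 / a * (u ^ (n - 1) * K u))
    (f' := fun u => u ^ (n - 1) * ∫ x, ρ x * Real.cos (u * a * x i))
    (by fun_prop) (fun u hu => ?_) (Continuous.intervalIntegrable (by fun_prop) _ _)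
  · rw [key]
    simp [hKdef]
  · have hid := hr.integral_cos_coord hρ i a u
    have hu0 : u ≠ 0 := hu.1.ne'
    refine (((hasDerivAt_pow (n - 1) u).mul (hK u)).const_mul (1 / a)).congr_deriv ?_
    change u * a * _ = _ * K u + _ at hid
    set C := ∫ x, ρ x * Real.cos (u * a * x i)
    set D := ∫ x : Eu n, ρ x * (a * (x i ^ 2 * Real.cos (u * a * x i)) / ‖x‖ ^ 2)
    rcases Nat.eq_zero_or_pos (n - 1) with h | h
    · rw [h] at hid ⊢
      simp only [Nat.cast_zero, zero_mul, zero_add] at hid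
      have : D = a * C := mul_left_cancel₀ hu0 (by linarith)
      simp [this, ha]
    · obtain ⟨m, hm⟩ : ∃ m, n - 1 = m + 1 := ⟨n - 1 - 1, by omega⟩
      rw [hm] at hid ⊢
      simp only [Nat.add_sub_cancel]
      field_simp
      rw [pow_succ]
      linear_combination -u ^ m * hid

/-- The exponential in the Fourier integral of an even weight may be replaced by a cosine. -/
lemma IsRadialFun.integral_mul_exp {ρ : Eu n → ℝ} (hr : IsRadialFun ρ)
    (hρ : Integrable ρ) (i : Fin n) (ξ : Eu n) (u : ℝ) :
    ∫ x, (ρ x : ℂ) * Complex.exp (-(2 * Real.pi * (u * ⟪x, ξ⟫_ℝ : ℝ) * Complex.I)) =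
      ((∫ x, ρ x * Real.cos (u * (2 * Real.pi * ‖ξ‖) * x i) : ℝ) : ℂ) := by
  have hodd : ∫ x, ρ x * Real.sin (2 * Real.pi * (u * ⟪x, ξ⟫_ℝ)) = 0 := by
    have h := hr.integral_comp_isometry (LinearIsometryEquiv.neg ℝ)
      (fun x => Real.sin (2 * Real.pi * (u * ⟪x, ξ⟫_ℝ)))
    simp only [LinearIsometryEquiv.coe_neg, inner_neg_left, mul_neg, Real.sin_neg,
      smul_eq_mul, integral_neg] at h
    linarith
  have hsplit : ∀ x, (ρ x : ℂ) *
      Complex.exp (-(2 * Real.pi * (u * ⟪x, ξ⟫_ℝ : ℝ) * Complex.I)) =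
      ((ρ x * Real.cos (2 * Real.pi * (u * ⟪x, ξ⟫_ℝ)) : ℝ) : ℂ) -
      ((ρ x * Real.sin (2 * Real.pi * (u * ⟪x, ξ⟫_ℝ)) : ℝ) : ℂ) * Complex.I := fun x => by
    rw [← neg_mul, Complex.exp_mul_I, Complex.cos_neg, Complex.sin_neg]
    push_cast
    ring
  simp only [hsplit]
  rw [integral_sub, integral_mul_const, integral_complex_ofReal, integral_complex_ofReal, hodd]
  · simp only [Complex.ofReal_zero, zero_mul, sub_zero]
    congr 1
    have := hr.integral_inner_eq (v := ξ) (w := ‖ξ‖ • EuclideanSpace.single i 1)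
      (by simp [norm_smul]) (fun s => Real.cos (2 * Real.pi * (u * s)))
    simp only [smul_eq_mul] at this
    rw [this]
    refine integral_congr_ae (ae_of_all _ fun x => ?_)
    simp only [inner_smul_right, EuclideanSpace.inner_single_right]
    simp
    left; congr 1; ring
  · exact (integrable_mul_of_abs_le hρ (by fun_prop) fun x => Real.abs_cos_le_one _).ofReal
  · exact (integrable_mul_of_abs_le hρ (by fun_prop)
      fun x => Real.abs_sin_le_one _).ofReal.mul_const _

/-- The substitution `t = ‖x‖ / u` in the definition of the potential. -/
lemma Qker_eq_integral_Ioo {ρ : Eu n → ℝ} {ρb : ℝ → ℝ} (hb : ∀ x : Eu n, x ≠ 0 → ρ x = ρb ‖x‖)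
    {x : Eu n} (hx : x ≠ 0) :
    Qker n ρb x = ∫ u in Ioo (0 : ℝ) 1, ρ (u⁻¹ • x) * u⁻¹ := by
  have hx0 : 0 < ‖x‖ := norm_pos_iff.2 hx
  have himg : (fun u : ℝ => ‖x‖ * u⁻¹) '' Ioo 0 1 = Ioi ‖x‖ := by
    ext t
    simp only [mem_image, mem_Ioo, mem_Ioi]
    constructor
    · rintro ⟨u, ⟨h0, h1⟩, rfl⟩
      exact lt_mul_of_one_lt_right hx0 ((one_lt_inv₀ h0).2 h1)
    · intro ht
      have ht0 := hx0.trans ht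
      exact ⟨‖x‖ / t, ⟨by positivity, (div_lt_one ht0).2 ht⟩, by field_simp⟩
  rw [Qker, ← himg, integral_image_eq_integral_abs_deriv_smul measurableSet_Ioo
    (f' := fun u => ‖x‖ * (-(u ^ 2)⁻¹))
    (fun u hu => ((hasDerivAt_inv hu.1.ne').const_mul _).hasDerivWithinAt)]
  · refine setIntegral_congr_fun measurableSet_Ioo fun u hu => ?_
    have hu0 : 0 < u := hu.1
    have hn : ‖u⁻¹ • x‖ = ‖x‖ * u⁻¹ := by
      rw [norm_smul, Real.norm_of_nonneg (by positivity), mul_comm]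
    simp only [smul_eq_mul]
    rw [hb (u⁻¹ • x) (smul_ne_zero (by positivity) hx), hn, mul_neg, abs_neg,
      abs_of_pos (by positivity)]
    field_simp
  · intro u _ v _ h
    exact inv_injective (mul_left_cancel₀ hx0.ne' h)

lemma integrable_prod_smul_mul_exp {ρ : Eu n → ℝ} (hρ : Integrable ρ) (hn : 0 < n) (ξ : Eu n) :
    Integrable (Function.uncurry fun (x : Eu n) (u : ℝ) => ((ρ (u⁻¹ • x) * u⁻¹ : ℝ) : ℂ) *
      Complex.exp (-(2 * Real.pi * (⟪x, ξ⟫_ℝ : ℝ) * Complex.I)))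
      (volume.prod (volume.restrict (Ioo (0 : ℝ) 1))) := by
  have hq : Measure.QuasiMeasurePreserving (fun p : Eu n × ℝ => p.2⁻¹ • p.1)
      (volume.prod (volume.restrict (Ioo (0 : ℝ) 1))) volume := by
    refine QuasiMeasurePreserving.prod_of_left (by fun_prop) ?_
    refine (ae_restrict_mem measurableSet_Ioo).mono fun u hu => ?_
    exact Measure.quasiMeasurePreserving_smul volume (inv_ne_zero hu.1.ne')
  have hnorm : ∀ (x : Eu n) (u : ℝ), ‖((ρ (u⁻¹ • x) * u⁻¹ : ℝ) : ℂ) *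
      Complex.exp (-(2 * Real.pi * (⟪x, ξ⟫_ℝ : ℝ) * Complex.I))‖ = |ρ (u⁻¹ • x)| * |u⁻¹| := by
    intro x u
    rw [norm_mul, Complex.norm_real, Real.norm_eq_abs, abs_mul, Complex.norm_exp]
    simp
  have hexp : Measurable fun p : Eu n × ℝ =>
      Complex.exp (-(2 * Real.pi * (⟪p.1, ξ⟫_ℝ : ℝ) * Complex.I)) := by fun_prop
  rw [integrable_prod_iff']
  · refine ⟨(ae_restrict_mem measurableSet_Ioo).mono fun u hu => ?_, ?_⟩
    · refine Integrable.mul_bdd (c := 1) ?_ (by fun_prop) (ae_of_all _ fun x => ?_)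
      · exact Integrable.ofReal (f := fun x => ρ (u⁻¹ • x) * u⁻¹)
          (((integrable_comp_smul_iff volume ρ (inv_ne_zero hu.1.ne')).2 hρ).mul_const _)
      · rw [Complex.norm_exp]; simp
    · simp only [Function.uncurry, hnorm]
      have h : IntegrableOn (fun u : ℝ => u ^ (n - 1) * ∫ x, |ρ x|) (Ioo 0 1) :=
        ((Continuous.integrableOn_Icc (by fun_prop)).mono_set Ioo_subset_Icc_self)
      refine h.congr_fun (fun u hu => ?_) measurableSet_Ioo
      have hu0 : 0 < u := hu.1
      simp only []
      rw [integral_mul_const, Measure.integral_comp_inv_smul volume (fun x => |ρ x|) u]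
      rw [abs_of_pos (inv_pos.2 hu0), abs_of_pos (by positivity), smul_eq_mul,
        finrank_euclideanSpace_fin]
      obtain ⟨m, rfl⟩ : ∃ m, n = m + 1 := ⟨n - 1, by omega⟩
      simp only [Nat.add_sub_cancel]
      field_simp
      ring
  · refine AEStronglyMeasurable.mul ?_ hexp.aestronglyMeasurable
    refine Complex.continuous_ofReal.comp_aestronglyMeasurable ?_
    exact (hρ.1.comp_quasiMeasurePreserving hq).mul (by fun_prop)

lemma integral_smul_mul_exp (ρ : Eu n → ℝ) (hn : 0 < n) (ξ : Eu n) {u : ℝ} (hu : 0 < u) :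
    ∫ x : Eu n, ((ρ (u⁻¹ • x) * u⁻¹ : ℝ) : ℂ) *
      Complex.exp (-(2 * Real.pi * (⟪x, ξ⟫_ℝ : ℝ) * Complex.I)) =
    ((u ^ (n - 1) : ℝ) : ℂ) * ∫ x, (ρ x : ℂ) *
      Complex.exp (-(2 * Real.pi * (u * ⟪x, ξ⟫_ℝ : ℝ) * Complex.I)) := by
  have h := Measure.integral_comp_inv_smul (volume : Measure (Eu n)) (fun x => (ρ x : ℂ) *
      Complex.exp (-(2 * Real.pi * (u * ⟪x, ξ⟫_ℝ : ℝ) * Complex.I))) u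
  have h1 : ∀ x : Eu n, ((ρ (u⁻¹ • x) * u⁻¹ : ℝ) : ℂ) *
      Complex.exp (-(2 * Real.pi * (⟪x, ξ⟫_ℝ : ℝ) * Complex.I)) =
      ((u⁻¹ : ℝ) : ℂ) * ((ρ (u⁻¹ • x) : ℂ) *
      Complex.exp (-(2 * Real.pi * (u * ⟪u⁻¹ • x, ξ⟫_ℝ : ℝ) * Complex.I))) := fun x => by
    rw [real_inner_smul_left, mul_inv_cancel_left₀ hu.ne']
    push_cast
    ring
  simp only [h1]
  rw [integral_const_mul, h, abs_of_pos (by positivity), finrank_euclideanSpace_fin,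
    Complex.real_smul, ← mul_assoc, ← Complex.ofReal_mul]
  obtain ⟨m, rfl⟩ : ∃ m, n = m + 1 := ⟨n - 1, by omega⟩
  congr 2
  simp only [Nat.add_sub_cancel]
  field_simp
  ring

variable (n)

/-- explicit formula for the Fourier transform of `Q_ρ`. -/
theorem stmt17 (hn : 0 < n) (ρ : Eu n → ℝ) (ρb : ℝ → ℝ) (ε : ℝ)
    (h0 : IsKernelH0 n ρ ρb ε) (hsupp : HasCompactSupport ρ)
    (ξ : Eu n) (hξ : ξ ≠ 0) :
    fInt (fun x => (Qker n ρb x : ℂ)) ξ =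
      ((1 / (2 * Real.pi * ‖ξ‖)) *
        ∫ x : Eu n, ρ x * x ⟨0, hn⟩ / ‖x‖ ^ 2 * Real.sin (2 * Real.pi * ‖ξ‖ * x ⟨0, hn⟩) :
        ℝ) := by
  obtain ⟨-, hb, hloc, -⟩ := h0
  have hρ : Integrable ρ := by
    have := hloc.integrableOn_isCompact hsupp
    exact (integrableOn_iff_integrable_of_support_subset (subset_tsupport ρ)).1 this
  have hr : IsRadialFun ρ := by
    intro x y h
    rcases eq_or_ne x 0 with rfl | hx
    · rw [norm_zero, eq_comm, norm_eq_zero] at h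
      rw [h]
    · have hy : y ≠ 0 := norm_pos_iff.1 (h ▸ norm_pos_iff.2 hx)
      rw [hb x hx, hb y hy, h]
  have : Nonempty (Fin n) := ⟨⟨0, hn⟩⟩
  have hne : ∀ᵐ x : Eu n, x ≠ 0 := by
    simp [ae_iff, measure_singleton]
  have ha : 2 * Real.pi * ‖ξ‖ ≠ 0 := by
    have := norm_pos_iff.2 hξ
    positivity
  calc fInt (fun x => (Qker n ρb x : ℂ)) ξ
      = ∫ x : Eu n, ∫ u in Ioo (0 : ℝ) 1, ((ρ (u⁻¹ • x) * u⁻¹ : ℝ) : ℂ) *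
          Complex.exp (-(2 * Real.pi * (⟪x, ξ⟫_ℝ : ℝ) * Complex.I)) := by
        refine integral_congr_ae (hne.mono fun x hx => ?_)
        simp only []
        rw [integral_mul_const, integral_complex_ofReal, Qker_eq_integral_Ioo hb hx]
    _ = ∫ u in Ioo (0 : ℝ) 1, ∫ x : Eu n, ((ρ (u⁻¹ • x) * u⁻¹ : ℝ) : ℂ) *
          Complex.exp (-(2 * Real.pi * (⟪x, ξ⟫_ℝ : ℝ) * Complex.I)) :=
        integral_integral_swap (integrable_prod_smul_mul_exp hρ hn ξ)
    _ = ∫ u in Ioo (0 : ℝ) 1, ((u ^ (n - 1) *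
          ∫ x, ρ x * Real.cos (u * (2 * Real.pi * ‖ξ‖) * x ⟨0, hn⟩) : ℝ) : ℂ) := by
        refine setIntegral_congr_fun measurableSet_Ioo fun u hu => ?_
        simp only []
        rw [integral_smul_mul_exp ρ hn ξ hu.1, hr.integral_mul_exp hρ ⟨0, hn⟩ ξ u,
          Complex.ofReal_mul]
    _ = _ := by
        rw [integral_complex_ofReal, ← integral_Ioc_eq_integral_Ioo,
          ← intervalIntegral.integral_of_le zero_le_one,
          hr.intervalIntegral_pow_mul_integral_cos hρ hn ⟨0, hn⟩ ha]
        congr 2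
        refine integral_congr_ae (ae_of_all _ fun x => ?_)
        ring
end
end

section
/- Let ρ satisfy (H0) and suppose supp ρ ⊆ B̄(0, R) for some R > 0. Then Q_ρ(x) := ∫_{|x|}^∞ ρ̄(t)/t dt vanishes for |x| > R and Q_ρ ∈ L¹(ℝ^n). -/
open MeasureTheory Metric Set Matrix
open scoped ENNReal InnerProductSpace

noncomputable section

variable {n : ℕ}

variable (n)

/-- A weighted Hardy-type estimate: the tail integral `r ↦ ∫_r^∞ f(t)/t dt` inherits integrability
against the weight `r ^ k` on the half-line. -/
theorem integrableOn_pow_mul_integral_Ioi_div (k : ℕ) (f : ℝ → ℝ)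
    (hf : IntegrableOn (fun t => t ^ k * f t) (Ioi 0)) :
    IntegrableOn (fun r => r ^ k * ∫ t in Ioi r, f t / t) (Ioi 0) := by
  set μ : Measure ℝ := volume.restrict (Ioi 0)
  have hpos : ∀ᵐ t ∂μ, 0 < t := ae_restrict_mem measurableSet_Ioi
  have hg : AEStronglyMeasurable (fun t => f t / t) μ := by
    have hmeas : Measurable fun t : ℝ => (t ^ (k + 1))⁻¹ := by fun_prop
    refine (hmeas.aestronglyMeasurable.mul hf.aestronglyMeasurable).congr ?_
    filter_upwards [hpos] with t ht
    simp only [Pi.mul_apply]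
    field_simp
    ring
  set F : ℝ × ℝ → ℝ := {p : ℝ × ℝ | p.1 < p.2}.indicator fun p => p.1 ^ k * (f p.2 / p.2)
  have hF : AEStronglyMeasurable F (μ.prod μ) := by
    refine AEStronglyMeasurable.indicator ?_ (measurableSet_lt measurable_fst measurable_snd)
    exact (by fun_prop : Measurable fun p : ℝ × ℝ => p.1 ^ k).aestronglyMeasurable.mul hg.comp_snd
  have hslice (t : ℝ) :
      (fun r => F (r, t)) = (Iio t).indicator fun r => r ^ k * (f t / t) := by
    ext r
    simp [F, indicator_apply]
  have hIoo (t : ℝ) : μ.restrict (Iio t) = volume.restrict (Ioo 0 t) := by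
    rw [Measure.restrict_restrict measurableSet_Iio, inter_comm, Ioi_inter_Iio]
  have hint : Integrable F (μ.prod μ) := by
    rw [integrable_prod_iff' hF]
    constructor
    · refine Filter.Eventually.of_forall fun t => ?_
      rw [hslice, integrable_indicator_iff measurableSet_Iio, IntegrableOn, hIoo]
      refine Integrable.mul_const ?_ _
      exact ((continuous_pow k).integrableOn_Icc (a := 0) (b := t)).mono_set Ioo_subset_Icc_self
    · refine (hf.norm.div_const ((k : ℝ) + 1)).congr ?_
      filter_upwards [hpos] with t ht
      have hnorm : (fun r => ‖F (r, t)‖)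
          = (Iio t).indicator fun r => ‖r ^ k * (f t / t)‖ := by
        ext r
        rw [← norm_indicator_eq_indicator_norm, ← hslice]
      rw [hnorm, integral_indicator measurableSet_Iio, hIoo]
      have hcongr : ∫ r in Ioo 0 t, ‖r ^ k * (f t / t)‖
          = ∫ r in Ioo 0 t, r ^ k * ‖f t / t‖ := by
        refine setIntegral_congr_fun measurableSet_Ioo fun r hr => ?_
        simp only [norm_mul, norm_pow, Real.norm_of_nonneg hr.1.le]
      rw [hcongr, integral_mul_const, ← integral_Ioc_eq_integral_Ioo,
        ← intervalIntegral.integral_of_le ht.le, integral_pow, norm_mul, norm_div, norm_pow,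
        Real.norm_of_nonneg ht.le]
      have hk : (k : ℝ) + 1 ≠ 0 := by positivity
      field_simp
      simp only [ne_eq, Nat.add_eq_zero_iff, one_ne_zero, and_false,
        not_false_eq_true, zero_pow, sub_zero]
      ring
  refine hint.integral_prod_left.congr ?_
  filter_upwards [hpos] with r hr
  have hslice_left : (fun t => F (r, t)) = (Ioi r).indicator fun t => r ^ k * (f t / t) := by
    ext t
    simp [F, indicator_apply]
  rw [hslice_left, integral_indicator measurableSet_Ioi,
    Measure.restrict_restrict measurableSet_Ioi,
    inter_eq_left.2 (Ioi_subset_Ioi hr.le), integral_const_mul]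

/-- `Q_ρ` vanishes outside the support radius of `ρ` and is integrable. -/
theorem stmt18 (hn : 0 < n) (ρ : Eu n → ℝ) (ρb : ℝ → ℝ) (ε : ℝ)
    (h0 : IsKernelH0 n ρ ρb ε) (R : ℝ) (hR : 0 < R)
    (hsupp : Function.support ρ ⊆ closedBall (0 : Eu n) R) :
    (∀ x : Eu n, R < ‖x‖ → Qker n ρb x = 0) ∧ Integrable (Qker n ρb) volume := by
  obtain ⟨-, hrad, hloc, -, -, -⟩ := h0
  have : Nonempty (Fin n) := ⟨⟨0, hn⟩⟩
  constructor
  · intro x hx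
    refine setIntegral_eq_zero_of_forall_eq_zero fun t ht => ?_
    have hRt : R < t := hx.trans ht
    obtain ⟨y, hy⟩ := exists_norm_eq (Eu n) (hR.trans hRt).le
    have hy0 : y ≠ 0 := norm_pos_iff.1 (hy ▸ hR.trans hRt)
    have hρy : ρ y = 0 := by
      by_contra h
      have hle : ‖y‖ ≤ R := by simpa using hsupp h
      linarith
    rw [← hy, ← hrad y hy0, hρy, zero_div]
  · have hint : Integrable ρ volume :=
      (integrableOn_iff_integrable_of_support_subset hsupp).1
        (hloc.integrableOn_isCompact (isCompact_closedBall _ _))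
    have hnorm : Integrable (fun x : Eu n => ρb ‖x‖) volume := by
      refine hint.congr ?_
      filter_upwards [Measure.ae_ne volume (0 : Eu n)] with x hx using hrad x hx
    rw [integrable_fun_norm_addHaar] at hnorm
    refine (integrable_fun_norm_addHaar (E := Eu n) volume
      (f := fun r => ∫ t in Ioi r, ρb t / t)).2 ?_
    exact integrableOn_pow_mul_integral_Ioi_div _ ρb hnorm
end
end
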